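/- arXiv:2102.07553 — 5 statements merged into one kernel-verified Lean document; each statement's English description precedes it below -/
import Mathlib

section
/- Let F̂ ∈ C^∞(ℝⁿ, ℝ) be a symmetric polynomial, homogeneous of degree d ∈ ℕ with d ≥ 1, satisfying F̂(λ)^{1/d} ≥ C (∏_{i=1}^n λ_i)^{1/n} for all λ ∈ Γₙ and some C > 0. Let Γ ⊂ ℝⁿ be a nonempty open symmetric convex cone such that Γₙ ⊂ Γ ⊂ Γ₁, ∂Γ ∩ ∂Γ₁ = {0}, F̂ > 0 in Γ, F̂ = 0 on ∂Γ, and F̂^{1/d} is concave in Γ. Then 𝒞 = λ^{-1}(Γ) = {A ∈ ℍⁿ : λ(A) ∈ Γ} is a nonempty open convex cone with 𝒞ₙ ⊂ 𝒞 ⊂ 𝒞₁, and F = F̂ ∘ λ satisfies: F ∈ C¹(closure 𝒞, ℝ) (indeed F extends to a C^∞ function on ℍⁿ); F > 0 on 𝒞; F is positively homogeneous of degree d on 𝒞; F^{1/d} is concave on 𝒞; F(P)^{1/d} ≥ C (det P)^{1/n} for all P ∈ 𝒞ₙ; and there exists R₀ > 0 such that for every R > R₀ the function F is uniformly elliptic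 on 𝒞_R = {A ∈ 𝒞 : Tr(A) < R and 1/R < F(A)}. -/
open scoped ComplexOrder

noncomputable section

/- `ℍⁿ`, the real vector space of `n×n` complex Hermitian matrices, equipped with the
Frobenius norm (coming from the inner product `⟨A,B⟩ = Tr(AB)`). -/
attribute [local instance] Matrix.frobeniusNormedAddCommGroup Matrix.frobeniusNormedSpace

def hermSubmodule (n : ℕ) : Submodule ℝ (Matrix (Fin n) (Fin n) ℂ) where
  carrier := {A | A.IsHermitian}
  add_mem' := fun ha hb => ha.add hb
  zero_mem' := Matrix.isHermitian_zero
  smul_mem' := fun c A hA => by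
    simpa [Matrix.IsHermitian, Matrix.conjTranspose_smul] using congrArg (c • ·) hA

/-- The normed real vector space of `n×n` complex Hermitian matrices with the
Frobenius norm. -/
abbrev Herm (n : ℕ) := hermSubmodule n

/-- The eigenvalues of a Hermitian matrix, sorted in nondecreasing order
(junk value `0` if the matrix is not Hermitian). -/
def sortedEigs {n : ℕ} (A : Matrix (Fin n) (Fin n) ℂ) : Fin n → ℝ :=
  if h : A.IsHermitian then h.eigenvalues ∘ Tuple.sort h.eigenvalues else 0

/-- `F` is uniformly elliptic on `S ⊆ ℍⁿ`: there are `0 < m ≤ M` with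
`m‖B−A‖ ≤ F(B) − F(A) ≤ M‖B−A‖` whenever `A, B ∈ S` and `B − A` is positive
semidefinite (Frobenius norm). -/
def UnifElliptic {n : ℕ} (F : Herm n → ℝ) (S : Set (Herm n)) : Prop :=
  ∃ m M : ℝ, 0 < m ∧ m ≤ M ∧ ∀ A ∈ S, ∀ B ∈ S,
    ((B : Matrix (Fin n) (Fin n) ℂ) - (A : Matrix (Fin n) (Fin n) ℂ)).PosSemidef →
      m * ‖B - A‖ ≤ F B - F A ∧ F B - F A ≤ M * ‖B - A‖

/-- The set `𝒞_R = {A ∈ 𝒞 : Tr(A) < R, 1/R < F(A)}`. -/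
def coneR {n : ℕ} (𝒞 : Set (Herm n)) (F : Herm n → ℝ) (R : ℝ) : Set (Herm n) :=
  {A ∈ 𝒞 | ((A : Matrix (Fin n) (Fin n) ℂ).trace).re < R ∧ 1 / R < F A}

/-- The identity matrix as an element of `Herm n`. -/
def hermOne (n : ℕ) : Herm n := ⟨1, Matrix.isHermitian_one⟩

lemma exists_sortedEigs_eq_comp {n : ℕ} {A : Matrix (Fin n) (Fin n) ℂ} (hA : A.IsHermitian) :
    ∃ ρ : Equiv.Perm (Fin n), sortedEigs A = hA.eigenvalues ∘ ρ :=
  ⟨Tuple.sort hA.eigenvalues, by simp [sortedEigs, hA]⟩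

/-- The matrix of squared moduli of the entries of a unitary matrix is doubly stochastic. -/
lemma normSq_mem_doublyStochastic {n : ℕ} {W : Matrix (Fin n) (Fin n) ℂ}
    (h₁ : W * star W = 1) (h₂ : star W * W = 1) (τ ρ : Equiv.Perm (Fin n)) :
    (Matrix.of fun i j => Complex.normSq (W (τ i) (ρ j))) ∈ doublyStochastic ℝ (Fin n) := by
  rw [mem_doublyStochastic_iff_sum]
  refine ⟨fun i j => Complex.normSq_nonneg _, fun i => ?_, fun j => ?_⟩
  · have h := congrArg Complex.re (congrFun (congrFun h₁ (τ i)) (τ i))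
    simp only [Matrix.mul_apply, Matrix.star_apply, Matrix.one_apply_eq, Complex.one_re,
      Complex.re_sum] at h
    rw [← h, ← Equiv.sum_comp ρ (fun j => (W (τ i) j * star (W (τ i) j)).re)]
    refine Finset.sum_congr rfl fun j _ => ?_
    simp [Complex.normSq_apply]
  · have h := congrArg Complex.re (congrFun (congrFun h₂ (ρ j)) (ρ j))
    simp only [Matrix.mul_apply, Matrix.star_apply, Matrix.one_apply_eq, Complex.one_re,
      Complex.re_sum] at h
    rw [← h, ← Equiv.sum_comp τ (fun i => (star (W i (ρ j)) * W i (ρ j)).re)]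
    refine Finset.sum_congr rfl fun i _ => ?_
    simp [Complex.normSq_apply]

/-- Taking diagonal entries in an eigenbasis of `C`: a linear map sending `C` to its spectrum and
every `A` to a convex combination of permutations of the spectrum of `A`. -/
lemma exists_pinching {n : ℕ} (C : Herm n) :
    ∃ L : Herm n →ₗ[ℝ] (Fin n → ℝ),
      L C = sortedEigs (C : Matrix (Fin n) (Fin n) ℂ) ∧ (L (hermOne n) = fun _ => 1) ∧
      ∀ A : Herm n, ∃ w : Equiv.Perm (Fin n) → ℝ, (∀ σ, 0 ≤ w σ) ∧ ∑ σ, w σ = 1 ∧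
        L A = ∑ σ, w σ • (sortedEigs (A : Matrix (Fin n) (Fin n) ℂ) ∘ σ) := by
  obtain ⟨C, hC⟩ := C
  have hC' : C.IsHermitian := hC
  obtain ⟨τ, hτ⟩ := exists_sortedEigs_eq_comp hC'
  set U := hC'.eigenvectorUnitary with hU
  have hU₁ : (U : Matrix (Fin n) (Fin n) ℂ) * star (U : Matrix (Fin n) (Fin n) ℂ) = 1 :=
    (Unitary.mem_iff.1 U.2).2
  have hU₂ : star (U : Matrix (Fin n) (Fin n) ℂ) * (U : Matrix (Fin n) (Fin n) ℂ) = 1 :=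
    (Unitary.mem_iff.1 U.2).1
  let L : Herm n →ₗ[ℝ] (Fin n → ℝ) :=
    { toFun := fun A i => ((star (U : Matrix (Fin n) (Fin n) ℂ) * (A : Matrix (Fin n) (Fin n) ℂ) *
          (U : Matrix (Fin n) (Fin n) ℂ)) (τ i) (τ i)).re
      map_add' := fun A B => by
        ext i; simp [Matrix.mul_add, Matrix.add_mul]
      map_smul' := fun c A => by
        ext i; simp }
  have hL : ∀ A i, L A i = ((star (U : Matrix (Fin n) (Fin n) ℂ) *
      (A : Matrix (Fin n) (Fin n) ℂ) * (U : Matrix (Fin n) (Fin n) ℂ)) (τ i) (τ i)).re :=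
    fun _ _ => rfl
  refine ⟨L, ?_, ?_, ?_⟩
  · ext i
    have h := hC'.spectral_theorem
    rw [Unitary.conjStarAlgAut_apply] at h
    rw [hL, hτ]
    simp only []
    conv_lhs => rw [h]
    rw [← hU]
    rw [show star (U : Matrix (Fin n) (Fin n) ℂ) * ((U : Matrix (Fin n) (Fin n) ℂ) *
      Matrix.diagonal (RCLike.ofReal ∘ hC'.eigenvalues) * star (U : Matrix (Fin n) (Fin n) ℂ)) *
      (U : Matrix (Fin n) (Fin n) ℂ) = (star (U : Matrix (Fin n) (Fin n) ℂ) * (U : Matrix (Fin n) (Fin n) ℂ)) *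
      Matrix.diagonal (RCLike.ofReal ∘ hC'.eigenvalues) *
      (star (U : Matrix (Fin n) (Fin n) ℂ) * (U : Matrix (Fin n) (Fin n) ℂ))
      by simp only [Matrix.mul_assoc], hU₂]
    simp
  · ext i
    rw [hL]
    simp [hermOne, hU₂]
  · rintro ⟨A, hA⟩
    have hA' : A.IsHermitian := hA
    obtain ⟨ρ, hρ⟩ := exists_sortedEigs_eq_comp hA'
    set V := hA'.eigenvectorUnitary with hV
    have hV₁ : (V : Matrix (Fin n) (Fin n) ℂ) * star (V : Matrix (Fin n) (Fin n) ℂ) = 1 :=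
      (Unitary.mem_iff.1 V.2).2
    have hV₂ : star (V : Matrix (Fin n) (Fin n) ℂ) * (V : Matrix (Fin n) (Fin n) ℂ) = 1 :=
      (Unitary.mem_iff.1 V.2).1
    set W : Matrix (Fin n) (Fin n) ℂ := star (U : Matrix (Fin n) (Fin n) ℂ) * V with hW
    have hW₁ : W * star W = 1 := by
      rw [hW, star_mul, star_star, Matrix.mul_assoc, ← Matrix.mul_assoc (V : Matrix (Fin n) (Fin n) ℂ),
        hV₁,
        Matrix.one_mul, hU₂]
    have hW₂ : star W * W = 1 := by
      rw [hW, star_mul, star_star, Matrix.mul_assoc, ← Matrix.mul_assoc (U : Matrix (Fin n) (Fin n) ℂ),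
        hU₁,
        Matrix.one_mul, hV₂]
    obtain ⟨w, hw₀, hw₁, hw⟩ :=
      exists_eq_sum_perm_of_mem_doublyStochastic (normSq_mem_doublyStochastic hW₁ hW₂ τ ρ)
    refine ⟨w, hw₀, hw₁, ?_⟩
    have key : L ⟨A, hA⟩ = (Matrix.of fun i j => Complex.normSq (W (τ i) (ρ j))).mulVec
        (hA'.eigenvalues ∘ ρ) := by
      ext i
      have h := hA'.spectral_theorem
      rw [Unitary.conjStarAlgAut_apply] at h
      rw [hL]
      simp only []
      conv_lhs => rw [h]
      rw [← hV, show star (U : Matrix (Fin n) (Fin n) ℂ) * ((V : Matrix (Fin n) (Fin n) ℂ) *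
        Matrix.diagonal (RCLike.ofReal ∘ hA'.eigenvalues) * star (V : Matrix (Fin n) (Fin n) ℂ)) *
        (U : Matrix (Fin n) (Fin n) ℂ) =
        W * Matrix.diagonal (RCLike.ofReal ∘ hA'.eigenvalues) * star W by
        rw [hW, star_mul, star_star]; simp only [Matrix.mul_assoc]]
      rw [Matrix.mul_apply, Complex.re_sum, ← Equiv.sum_comp ρ]
      simp only [Matrix.mulVec, dotProduct]
      refine Finset.sum_congr rfl fun j _ => ?_
      simp [Matrix.mul_diagonal, Complex.normSq_apply]
      ring
    rw [key, ← hw, Matrix.sum_mulVec, hρ]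
    refine Finset.sum_congr rfl fun σ _ => ?_
    rw [Matrix.smul_mulVec, Matrix.permMatrix_mulVec]

/-- A Hermitian perturbation of norm less than `ε` of `ε • 1` is positive definite. -/
lemma posDef_add_smul_one {n : ℕ} (D : Herm n) {ε : ℝ} (hD : ‖D‖ < ε) :
    ((D + ε • hermOne n : Herm n) : Matrix (Fin n) (Fin n) ℂ).PosDef := by
  have hH : ((D + ε • hermOne n : Herm n) : Matrix (Fin n) (Fin n) ℂ).IsHermitian :=
    (D + ε • hermOne n).2
  rw [hH.posDef_iff_eigenvalues_pos]
  intro i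
  set v := hH.eigenvectorBasis i with hv
  set μ := hH.eigenvalues i with hμ
  have hvn : ‖v‖ = 1 := hH.eigenvectorBasis.orthonormal.1 i
  have h := hH.mulVec_eigenvectorBasis i
  have hDv : (D : Matrix (Fin n) (Fin n) ℂ).mulVec v.ofLp = (μ - ε) • v.ofLp := by
    rw [sub_smul, eq_sub_iff_add_eq, ← h]
    have : ((ε • hermOne n : Herm n) : Matrix (Fin n) (Fin n) ℂ).mulVec v.ofLp = ε • v.ofLp := by
      simp [hermOne, Matrix.smul_mulVec]
    rw [← this, ← Matrix.add_mulVec]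
    rfl
  have hcol : (D : Matrix (Fin n) (Fin n) ℂ) * Matrix.replicateCol Unit v.ofLp =
      (μ - ε) • Matrix.replicateCol Unit v.ofLp := by
    rw [← Matrix.replicateCol_smul, ← hDv, Matrix.replicateCol_mulVec]
  have hle := Matrix.frobenius_norm_mul (D : Matrix (Fin n) (Fin n) ℂ)
    (Matrix.replicateCol Unit v.ofLp)
  rw [hcol, norm_smul, Matrix.frobenius_norm_replicateCol] at hle
  have : WithLp.toLp 2 v.ofLp = v := rfl
  rw [this, hvn, mul_one, mul_one, Real.norm_eq_abs] at hle
  have hlt : |μ - ε| < ε := lt_of_le_of_lt hle hD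
  have := (abs_lt.1 hlt).1
  linarith

lemma sum_sortedEigs {n : ℕ} (A : Herm n) :
    ∑ i, sortedEigs (A : Matrix (Fin n) (Fin n) ℂ) i =
      ((A : Matrix (Fin n) (Fin n) ℂ).trace).re := by
  have hA : (A : Matrix (Fin n) (Fin n) ℂ).IsHermitian := A.2
  obtain ⟨ρ, hρ⟩ := exists_sortedEigs_eq_comp hA
  rw [hρ, hA.trace_eq_sum_eigenvalues, Complex.re_sum]
  exact Equiv.sum_comp ρ hA.eigenvalues

lemma prod_sortedEigs {n : ℕ} (A : Herm n) :
    ∏ i, sortedEigs (A : Matrix (Fin n) (Fin n) ℂ) i =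
      ((A : Matrix (Fin n) (Fin n) ℂ).det).re := by
  have hA : (A : Matrix (Fin n) (Fin n) ℂ).IsHermitian := A.2
  obtain ⟨ρ, hρ⟩ := exists_sortedEigs_eq_comp hA
  have h : ((∏ i, hA.eigenvalues i : ℝ) : ℂ) = (A : Matrix (Fin n) (Fin n) ℂ).det := by
    rw [hA.det_eq_prod_eigenvalues]; push_cast; rfl
  rw [hρ, ← h, Complex.ofReal_re]
  exact Equiv.prod_comp ρ hA.eigenvalues

lemma sortedEigs_pos {n : ℕ} {A : Matrix (Fin n) (Fin n) ℂ} (hA : A.PosDef) (i : Fin n) :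
    0 < sortedEigs A i := by
  obtain ⟨ρ, hρ⟩ := exists_sortedEigs_eq_comp hA.1
  rw [hρ]
  exact hA.eigenvalues_pos _

lemma eq_zero_of_sortedEigs_eq_zero {n : ℕ} (A : Herm n)
    (h : sortedEigs (A : Matrix (Fin n) (Fin n) ℂ) = 0) : A = 0 := by
  have hA : (A : Matrix (Fin n) (Fin n) ℂ).IsHermitian := A.2
  obtain ⟨ρ, hρ⟩ := exists_sortedEigs_eq_comp hA
  apply Subtype.ext
  refine hA.eigenvalues_eq_zero_iff.1 ?_
  ext i
  have := congrFun (hρ.symm.trans h) (ρ.symm i)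
  simpa using this

lemma sum_sortedEigs_pow {n : ℕ} (A : Herm n) (k : ℕ) :
    ∑ i, sortedEigs (A : Matrix (Fin n) (Fin n) ℂ) i ^ k =
      (((A : Matrix (Fin n) (Fin n) ℂ) ^ k).trace).re := by
  have hA : (A : Matrix (Fin n) (Fin n) ℂ).IsHermitian := A.2
  obtain ⟨ρ, hρ⟩ := exists_sortedEigs_eq_comp hA
  have h : (A : Matrix (Fin n) (Fin n) ℂ) ^ k = _ := congrArg (· ^ k) hA.spectral_theorem
  rw [← map_pow, Unitary.conjStarAlgAut_apply] at h
  rw [hρ, h, Matrix.trace_mul_comm, ← Matrix.mul_assoc, Unitary.coe_star_mul_self, Matrix.one_mul,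
    Matrix.diagonal_pow, Matrix.trace_diagonal, Complex.re_sum]
  refine (Equiv.sum_comp ρ fun i => hA.eigenvalues i ^ k).trans
    (Finset.sum_congr rfl fun i _ => ?_)
  simp [← Complex.ofReal_pow]

open scoped ContDiff in
lemma contDiff_re_trace_pow (n k : ℕ) : ContDiff ℝ ω
    (fun A : Herm n => (((A : Matrix (Fin n) (Fin n) ℂ) ^ k).trace).re) := by
  have hentry : ∀ i j, ContDiff ℝ ω (fun A : Herm n => (A : Matrix (Fin n) (Fin n) ℂ) i j) := by
    intro i j
    let l : Herm n →ₗ[ℝ] ℂ :=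
      { toFun := fun A => (A : Matrix (Fin n) (Fin n) ℂ) i j
        map_add' := fun _ _ => rfl
        map_smul' := fun _ _ => rfl }
    exact l.toContinuousLinearMap.contDiff
  have hpow : ∀ (k : ℕ) (i j : Fin n),
      ContDiff ℝ ω (fun A : Herm n => ((A : Matrix (Fin n) (Fin n) ℂ) ^ k) i j) := by
    intro k
    induction k with
    | zero => intro i j; simp only [pow_zero]; exact contDiff_const
    | succ k ih =>
      intro i j
      simp only [pow_succ, Matrix.mul_apply]
      exact ContDiff.sum fun l _ => (ih i l).mul (hentry l j)
  have htr : ContDiff ℝ ω (fun A : Herm n => ((A : Matrix (Fin n) (Fin n) ℂ) ^ k).trace) := by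
    simp only [Matrix.trace, Matrix.diag_apply]
    exact ContDiff.sum fun i _ => hpow k i i
  exact Complex.reCLM.contDiff.comp htr

open scoped ContDiff in
lemma contDiff_esymm_sortedEigs (n k : ℕ) : ContDiff ℝ ω
    (fun A : Herm n => MvPolynomial.eval (sortedEigs (A : Matrix (Fin n) (Fin n) ℂ))
      (MvPolynomial.esymm (Fin n) ℝ k)) := by
  induction k using Nat.strong_induction_on with
  | _ k ih =>
    rcases Nat.eq_zero_or_pos k with rfl | hk
    · simpa using contDiff_const
    have h : (fun A : Herm n => MvPolynomial.eval (sortedEigs (A : Matrix (Fin n) (Fin n) ℂ))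
        (MvPolynomial.esymm (Fin n) ℝ k)) = fun A : Herm n => (k : ℝ)⁻¹ * ((-1) ^ (k + 1) *
        ∑ a ∈ Finset.HasAntidiagonal.antidiagonal k with a.1 < k, (-1) ^ a.1 *
          MvPolynomial.eval (sortedEigs (A : Matrix (Fin n) (Fin n) ℂ))
            (MvPolynomial.esymm (Fin n) ℝ a.1) *
          (((A : Matrix (Fin n) (Fin n) ℂ) ^ a.2).trace).re) := by
      ext A
      have hN := congrArg (MvPolynomial.eval (sortedEigs (A : Matrix (Fin n) (Fin n) ℂ)))
        (MvPolynomial.mul_esymm_eq_sum (Fin n) ℝ k)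
      simp only [map_mul, map_sum, map_pow, map_neg, map_one, map_natCast, MvPolynomial.psum,
        MvPolynomial.eval_X, sum_sortedEigs_pow] at hN
      rw [← hN, inv_mul_cancel_left₀ (by positivity)]
    rw [h]
    refine contDiff_const.mul (contDiff_const.mul (ContDiff.sum fun a ha => ?_))
    exact (contDiff_const.mul (ih a.1 (Finset.mem_filter.1 ha).2)).mul (contDiff_re_trace_pow n a.2)

open scoped ContDiff in
/-- A symmetric polynomial of the eigenvalues is an analytic function of the matrix. -/
lemma contDiff_symmetric_comp_sortedEigs {n : ℕ} {f : (Fin n → ℝ) → ℝ}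
    (hpoly : ∃ P : MvPolynomial (Fin n) ℝ, ∀ x, f x = MvPolynomial.eval x P)
    (hsymm : ∀ (σ : Equiv.Perm (Fin n)) (x : Fin n → ℝ), f (x ∘ σ) = f x) :
    ContDiff ℝ ω (fun A : Herm n => f (sortedEigs (A : Matrix (Fin n) (Fin n) ℂ))) := by
  obtain ⟨P, hP⟩ := hpoly
  have hPs : P.IsSymmetric := fun σ => MvPolynomial.funext fun x => by
    rw [MvPolynomial.eval_rename, ← hP, ← hP, hsymm]
  obtain ⟨Q, hQ⟩ := MvPolynomial.esymmAlgHom_surjective (σ := Fin n) (n := n) ℝ (by simp)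
    ⟨P, hPs⟩
  have hQ' : MvPolynomial.aeval (fun i : Fin n => MvPolynomial.esymm (Fin n) ℝ (i + 1)) Q = P := by
    rw [← MvPolynomial.esymmAlgHom_apply, hQ]
  have h : (fun A : Herm n => f (sortedEigs (A : Matrix (Fin n) (Fin n) ℂ))) = fun A : Herm n =>
      MvPolynomial.eval (fun i : Fin n =>
        MvPolynomial.eval (sortedEigs (A : Matrix (Fin n) (Fin n) ℂ))
          (MvPolynomial.esymm (Fin n) ℝ (i + 1))) Q := by
    ext A
    rw [hP, ← hQ', ← MvPolynomial.coe_aeval_eq_eval, ← MvPolynomial.coe_aeval_eq_eval]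
    simp only [RingHom.coe_coe]
    rw [← AlgHom.comp_apply, MvPolynomial.comp_aeval]
  rw [h]
  simp only [MvPolynomial.eval_eq]
  exact ContDiff.sum fun m _ => contDiff_const.mul
    (contDiff_prod fun i _ => (contDiff_esymm_sortedEigs n _).pow _)

/-- A concave function on `[0, ∞)` that is nonnegative there and has nonpositive derivative at `0`
is constant. -/
lemma concaveOn_Ici_eq_of_deriv_nonpos {g : ℝ → ℝ} {g' : ℝ} (hg : ConcaveOn ℝ (Set.Ici 0) g)
    (hpos : ∀ t, 0 ≤ t → 0 < g t) (hd : HasDerivAt g g' 0) (hg' : g' ≤ 0) {t : ℝ} (ht : 0 < t) :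
    g t = g 0 := by
  refine le_antisymm ?_ ?_
  · have h := (hg.slope_le_of_hasDerivAt (Set.mem_Ici.2 le_rfl) (Set.mem_Ici.2 ht.le) ht hd).trans
      hg'
    rw [slope_def_field, sub_zero, div_le_iff₀ ht] at h
    linarith
  · by_contra! hlt
    have h0 := hpos 0 le_rfl
    have ht0 := hpos t ht.le
    have hsub : 0 < g 0 - g t := sub_pos.2 hlt
    set a : ℝ := (g 0 - g t) / (2 * g 0) with ha
    have ha0 : 0 < a := by positivity
    have ha1 : a ≤ 1 := by
      rw [ha, div_le_one (by positivity)]; linarith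
    have hs : 0 ≤ t / a := by positivity
    have h := hg.2 (Set.mem_Ici.2 le_rfl) (Set.mem_Ici.2 hs) (sub_nonneg.2 ha1) ha0.le (by ring)
    have e : (1 - a) • (0 : ℝ) + a • (t / a) = t := by
      simp only [smul_eq_mul]; field_simp; ring
    rw [e] at h
    simp only [smul_eq_mul] at h
    have h2 : a * g 0 = (g 0 - g t) / 2 := by
      rw [ha]; field_simp
    have h3 := mul_pos ha0 (hpos _ hs)
    nlinarith

section Ellipticity

variable {E : Type*} [NormedAddCommGroup E] [NormedSpace ℝ E]

open scoped ContDiff in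
/-- Strict monotonicity of an analytic function `F` with concave power on an open set `𝒞` on whose
boundary it is nonpositive, in directions `N` along which `𝒞` is invariant and which leave `𝒞`
backwards. -/
lemma fderiv_pos_of_concaveOn_rpow {𝒞 : Set E} {F : E → ℝ} {p : ℝ} (hp : 0 < p)
    (hopen : IsOpen 𝒞) (hF : ContDiff ℝ ω F) (hpos : ∀ A ∈ 𝒞, 0 < F A)
    (hconc : ConcaveOn ℝ 𝒞 fun A => F A ^ p) (hcl : ∀ A ∈ closure 𝒞, 0 < F A → A ∈ 𝒞)
    (ℓ : E →L[ℝ] ℝ) (hℓ : ∀ A ∈ 𝒞, 0 < ℓ A) {X N : E} (hX : X ∈ 𝒞)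
    (hray : ∀ t : ℝ, 0 ≤ t → X + t • N ∈ 𝒞) (hN : 0 < ℓ N) : 0 < fderiv ℝ F X N := by
  by_contra! hle
  let γ : ℝ →ᵃ[ℝ] E := AffineMap.lineMap X (X + N)
  have hγ : ∀ t, γ t = X + t • N := fun t => by
    simp [γ, AffineMap.lineMap_apply, add_comm]
  have hγc : ContDiff ℝ ω fun t : ℝ => X + t • N := by fun_prop
  set φ : ℝ → ℝ := fun t => F (X + t • N) with hφ
  have hφc : ContDiff ℝ ω φ := hF.comp hγc
  have hφd : HasDerivAt φ (fderiv ℝ F X N) 0 := by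
    have h1 : HasDerivAt (fun t : ℝ => X + t • N) N 0 := by
      simpa using ((hasDerivAt_id (0 : ℝ)).smul_const N).const_add X
    have h2 : HasFDerivAt F (fderiv ℝ F X) (X + (0 : ℝ) • N) := by
      simpa using (hF.differentiable (by simp) X).hasFDerivAt
    exact h2.comp_hasDerivAt 0 h1
  have hφ0 : φ 0 = F X := by simp [hφ]
  have hφpos : ∀ t, 0 ≤ t → 0 < φ t := fun t ht => hpos _ (hray t ht)
  have hgconc : ConcaveOn ℝ (Set.Ici 0) fun t => φ t ^ p := by
    have h := (hconc.comp_affineMap γ).subset (s := Set.Ici 0)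
      (fun t ht => by rw [Set.mem_preimage, hγ]; exact hray t ht) (convex_Ici 0)
    have e : ((fun A => F A ^ p) ∘ γ) = fun t => φ t ^ p := by
      ext t; simp [hφ, hγ]
    rwa [e] at h
  have hgd : HasDerivAt (fun t => φ t ^ p) (fderiv ℝ F X N * p * φ 0 ^ (p - 1)) 0 :=
    hφd.rpow_const (Or.inl (hφpos 0 le_rfl).ne')
  have hconst : ∀ t, 0 < t → φ t = φ 0 := fun t ht => by
    have h := concaveOn_Ici_eq_of_deriv_nonpos hgconc
      (fun s hs => Real.rpow_pos_of_pos (hφpos s hs) p) hgd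
      (mul_nonpos_of_nonpos_of_nonneg (mul_nonpos_of_nonpos_of_nonneg hle hp.le)
        (Real.rpow_nonneg (hφpos 0 le_rfl).le _)) ht
    exact (Real.rpow_left_inj (hφpos t ht.le).le (hφpos 0 le_rfl).le hp.ne').1 h
  have hφall : φ = fun _ => φ 0 := by
    refine AnalyticOnNhd.eq_of_eventuallyEq (𝕜 := ℝ) (z₀ := 1)
      (contDiff_omega_iff_analyticOnNhd.1 hφc) (fun _ _ => analyticAt_const) ?_
    filter_upwards [lt_mem_nhds (zero_lt_one' ℝ)] with t ht using hconst t ht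
  have hclopen : IsClopen ((fun t : ℝ => X + t • N) ⁻¹' 𝒞) := by
    refine ⟨isClosed_of_closure_subset fun t ht => ?_, hopen.preimage hγc.continuous⟩
    refine hcl _ (hγc.continuous.closure_preimage_subset _ ht) ?_
    change 0 < φ t
    rw [hφall]
    exact hφpos 0 le_rfl
  have huniv := hclopen.eq_univ ⟨0, by simpa using hX⟩
  have hmem : X + (-(ℓ X / ℓ N)) • N ∈ 𝒞 := by
    have : -(ℓ X / ℓ N) ∈ (fun t : ℝ => X + t • N) ⁻¹' 𝒞 := huniv ▸ Set.mem_univ _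
    exact this
  have := hℓ _ hmem
  rw [map_add, map_smul, smul_eq_mul, neg_mul, div_mul_cancel₀ _ hN.ne'] at this
  linarith

variable [FiniteDimensional ℝ E]

open scoped ContDiff in
/-- Uniform ellipticity, with respect to a closed cone `P` of directions, on the bounded part
`{ℓ < R, 1/R < F}` of `𝒞`. -/
lemma exists_ellipticity_bounds {𝒞 P : Set E} {F : E → ℝ} {p : ℝ} (hp : 0 < p)
    (hopen : IsOpen 𝒞) (hF : ContDiff ℝ ω F) (hpos : ∀ A ∈ 𝒞, 0 < F A)
    (hconc : ConcaveOn ℝ 𝒞 fun A => F A ^ p) (hcl : ∀ A ∈ closure 𝒞, 0 < F A → A ∈ 𝒞)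
    (ℓ : E →L[ℝ] ℝ) (hℓ : ∀ A ∈ 𝒞, 0 < ℓ A) (hP : IsClosed P)
    (hPsmul : ∀ c : ℝ, 0 ≤ c → ∀ N ∈ P, c • N ∈ P) (hPadd : ∀ X ∈ 𝒞, ∀ N ∈ P, X + N ∈ 𝒞)
    (hPℓ : ∀ N ∈ P, N ≠ 0 → 0 < ℓ N) {δ : ℝ} (hδ : 0 < δ)
    (hbd : ∀ A ∈ closure 𝒞, δ * ‖A‖ ≤ ℓ A) {R : ℝ} (hR : 0 < R) :
    ∃ m M : ℝ, 0 < m ∧ m ≤ M ∧ ∀ A ∈ 𝒞, ℓ A < R → 1 / R < F A → ∀ B ∈ 𝒞, ℓ B < R → 1 / R < F B →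
      B - A ∈ P → m * ‖B - A‖ ≤ F B - F A ∧ F B - F A ≤ M * ‖B - A‖ := by
  have : ProperSpace E := FiniteDimensional.proper ℝ E
  set K : Set E := closure 𝒞 ∩ {A | ℓ A ≤ R} ∩ {A | 1 / R ≤ F A} with hK
  have hKc : IsCompact K := by
    refine Metric.isCompact_of_isClosed_isBounded ((isClosed_closure.inter
      (isClosed_le ℓ.continuous continuous_const)).inter
      (isClosed_le continuous_const hF.continuous)) ?_
    refine (Metric.isBounded_closedBall (x := (0 : E)) (r := R / δ)).subset ?_
    rintro A ⟨⟨hA, hAR⟩, -⟩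
    rw [mem_closedBall_zero_iff, le_div_iff₀ hδ, mul_comm]
    exact (hbd A hA).trans hAR
  have hK𝒞 : K ⊆ 𝒞 := fun A hA => hcl A hA.1.1 ((by positivity : 0 < 1 / R).trans_le hA.2)
  have hdc : Continuous (fderiv ℝ F) := hF.continuous_fderiv (by simp)
  obtain ⟨m, hm, hmle⟩ : ∃ m, 0 < m ∧ ∀ q ∈ K ×ˢ (P ∩ Metric.sphere 0 1),
      m ≤ fderiv ℝ F q.1 q.2 := by
    refine (hKc.prod ((isCompact_sphere (0 : E) 1).inter_left hP)).exists_forall_le'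
      (f := fun q : E × E => fderiv ℝ F q.1 q.2) ?_ ?_
    · exact ((hdc.comp continuous_fst).clm_apply continuous_snd).continuousOn
    · rintro ⟨X, N⟩ ⟨hX, hN, hN1⟩
      have hN0 : N ≠ 0 := by
        rintro rfl; simp at hN1
      exact fderiv_pos_of_concaveOn_rpow hp hopen hF hpos hconc hcl ℓ hℓ (hK𝒞 hX)
        (fun t ht => hPadd X (hK𝒞 hX) _ (hPsmul t ht N hN)) (hPℓ N hN hN0)
  obtain ⟨M, hM⟩ := hKc.exists_bound_of_continuousOn hdc.continuousOn
  refine ⟨m, max m M, hm, le_max_left _ _, fun A hA hAR hAF B hB hBR hBF hAB => ?_⟩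
  obtain ⟨Z, hZ, hZe⟩ := domain_mvt (f := F) (s := Set.univ) (f' := fderiv ℝ F)
    (fun x _ => (hF.differentiable (by simp) x).hasFDerivAt.hasFDerivWithinAt) convex_univ
    (Set.mem_univ A) (Set.mem_univ B)
  have hseg : segment ℝ A B ⊆ K := by
    have hconv : Convex ℝ {X ∈ 𝒞 | (1 / R) ^ p < F X ^ p} := hconc.convex_gt _
    have hRp : ∀ X ∈ 𝒞, 1 / R < F X ↔ (1 / R) ^ p < F X ^ p := fun X hX =>
      (Real.rpow_lt_rpow_iff (by positivity) (hpos X hX).le hp).symm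
    intro X hX
    have h1 := hconv.segment_subset ⟨hA, (hRp A hA).1 hAF⟩ ⟨hB, (hRp B hB).1 hBF⟩ hX
    have h2 : ℓ X < R := (convex_halfSpace_lt ℓ.isLinear R).segment_subset hAR hBR hX
    exact ⟨⟨subset_closure h1.1, h2.le⟩, ((hRp X h1.1).2 h1.2).le⟩
  rw [hZe]
  constructor
  · rcases eq_or_ne (B - A) 0 with h0 | h0
    · simp [h0]
    have hn : 0 < ‖B - A‖ := norm_pos_iff.2 h0
    have h := hmle (Z, ‖B - A‖⁻¹ • (B - A)) ⟨hseg hZ, hPsmul _ (by positivity) _ hAB, by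
      simp [norm_smul, hn.ne']⟩
    simp only [map_smul, smul_eq_mul] at h
    rwa [← div_eq_inv_mul, le_div_iff₀ hn] at h
  · calc fderiv ℝ F Z (B - A) ≤ ‖fderiv ℝ F Z (B - A)‖ := le_abs_self _
      _ ≤ ‖fderiv ℝ F Z‖ * ‖B - A‖ := ContinuousLinearMap.le_opNorm _ _
      _ ≤ max m M * ‖B - A‖ := by
        gcongr
        exact (hM Z (hseg hZ)).trans (le_max_right _ _)

/-- A functional positive on the nonzero part of a closed cone controls the norm there. -/
lemma exists_norm_le_of_pos_on_cone {S : Set E} (hS : IsClosed S)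
    (hsmul : ∀ c : ℝ, 0 < c → ∀ A ∈ S, c • A ∈ S) (ℓ : E →L[ℝ] ℝ)
    (hℓ : ∀ A ∈ S, A ≠ 0 → 0 < ℓ A) : ∃ δ > 0, ∀ A ∈ S, δ * ‖A‖ ≤ ℓ A := by
  have : ProperSpace E := FiniteDimensional.proper ℝ E
  obtain ⟨δ, hδ, h⟩ := ((isCompact_sphere (0 : E) 1).inter_left hS).exists_forall_le'
    (f := ℓ) ℓ.continuous.continuousOn (a := 0) fun A hA => hℓ A hA.1 (by
      rintro rfl; simp at hA)
  refine ⟨δ, hδ, fun A hA => ?_⟩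
  rcases eq_or_ne A 0 with rfl | h0
  · simp
  have hn : 0 < ‖A‖ := norm_pos_iff.2 h0
  have h := h (‖A‖⁻¹ • A) ⟨hsmul _ (by positivity) _ hA, by simp [norm_smul, hn.ne']⟩
  rwa [map_smul, smul_eq_mul, ← div_eq_inv_mul, le_div_iff₀ hn] at h

end Ellipticity

lemma perm_average_mem_and_le {n : ℕ} {Γ : Set (Fin n → ℝ)} {g : (Fin n → ℝ) → ℝ}
    (hΓsymm : ∀ (σ : Equiv.Perm (Fin n)), ∀ x ∈ Γ, x ∘ σ ∈ Γ) (hconc : ConcaveOn ℝ Γ g)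
    (hg : ∀ (σ : Equiv.Perm (Fin n)) (x : Fin n → ℝ), g (x ∘ σ) = g x)
    {w : Equiv.Perm (Fin n) → ℝ} (hw₀ : ∀ σ, 0 ≤ w σ) (hw₁ : ∑ σ, w σ = 1)
    {x : Fin n → ℝ} (hx : x ∈ Γ) :
    ∑ σ, w σ • (x ∘ σ) ∈ Γ ∧ g x ≤ g (∑ σ, w σ • (x ∘ σ)) := by
  refine ⟨hconc.1.sum_mem (fun σ _ => hw₀ σ) hw₁ fun σ _ => hΓsymm σ x hx, ?_⟩
  have h := hconc.le_map_sum (fun σ (_ : σ ∈ Finset.univ) => hw₀ σ) hw₁ fun σ _ => hΓsymm σ x hx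
  simpa [hg, ← Finset.sum_mul, hw₁] using h

/-- The linear map of `exists_pinching` preserves a symmetric convex set `Γ` and increases a
symmetric concave function `g`. -/
lemma exists_pinching_concaveOn {n : ℕ} {Γ : Set (Fin n → ℝ)} {g : (Fin n → ℝ) → ℝ}
    (hΓsymm : ∀ (σ : Equiv.Perm (Fin n)), ∀ x ∈ Γ, x ∘ σ ∈ Γ) (hconc : ConcaveOn ℝ Γ g)
    (hg : ∀ (σ : Equiv.Perm (Fin n)) (x : Fin n → ℝ), g (x ∘ σ) = g x) (C : Herm n) :
    ∃ L : Herm n →ₗ[ℝ] (Fin n → ℝ),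
      L C = sortedEigs (C : Matrix (Fin n) (Fin n) ℂ) ∧ (L (hermOne n) = fun _ => 1) ∧
      ∀ A : Herm n, sortedEigs (A : Matrix (Fin n) (Fin n) ℂ) ∈ Γ →
        L A ∈ Γ ∧ g (sortedEigs (A : Matrix (Fin n) (Fin n) ℂ)) ≤ g (L A) := by
  obtain ⟨L, hL₁, hL₂, hL⟩ := exists_pinching C
  refine ⟨L, hL₁, hL₂, fun A hA => ?_⟩
  obtain ⟨w, hw₀, hw₁, hw⟩ := hL A
  rw [hw]
  exact perm_average_mem_and_le hΓsymm hconc hg hw₀ hw₁ hA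

lemma concaveOn_comp_sortedEigs {n : ℕ} {Γ : Set (Fin n → ℝ)} {g : (Fin n → ℝ) → ℝ}
    (hΓsymm : ∀ (σ : Equiv.Perm (Fin n)), ∀ x ∈ Γ, x ∘ σ ∈ Γ) (hconc : ConcaveOn ℝ Γ g)
    (hg : ∀ (σ : Equiv.Perm (Fin n)) (x : Fin n → ℝ), g (x ∘ σ) = g x) :
    ConcaveOn ℝ {A : Herm n | sortedEigs (A : Matrix (Fin n) (Fin n) ℂ) ∈ Γ}
      (fun A : Herm n => g (sortedEigs (A : Matrix (Fin n) (Fin n) ℂ))) := by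
  have key : ∀ A : Herm n, sortedEigs (A : Matrix (Fin n) (Fin n) ℂ) ∈ Γ →
      ∀ B : Herm n, sortedEigs (B : Matrix (Fin n) (Fin n) ℂ) ∈ Γ →
      ∀ a b : ℝ, 0 ≤ a → 0 ≤ b → a + b = 1 →
      sortedEigs ((a • A + b • B : Herm n) : Matrix (Fin n) (Fin n) ℂ) ∈ Γ ∧
      a * g (sortedEigs (A : Matrix (Fin n) (Fin n) ℂ)) +
        b * g (sortedEigs (B : Matrix (Fin n) (Fin n) ℂ)) ≤
        g (sortedEigs ((a • A + b • B : Herm n) : Matrix (Fin n) (Fin n) ℂ)) := by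
    intro A hA B hB a b ha hb hab
    obtain ⟨L, hL₁, -, hL⟩ := exists_pinching_concaveOn hΓsymm hconc hg (a • A + b • B)
    rw [← hL₁, map_add, map_smul, map_smul]
    refine ⟨hconc.1 (hL A hA).1 (hL B hB).1 ha hb hab, ?_⟩
    refine le_trans ?_ (hconc.2 (hL A hA).1 (hL B hB).1 ha hb hab)
    simp only [smul_eq_mul]
    gcongr
    · exact (hL A hA).2
    · exact (hL B hB).2
  exact ⟨fun A hA B hB a b ha hb hab => (key A hA B hB a b ha hb hab).1,
    fun A hA B hB a b ha hb hab => (key A hA B hB a b ha hb hab).2⟩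

lemma exists_sub_const_mem_of_isOpen {n : ℕ} {Γ : Set (Fin n → ℝ)} (hopen : IsOpen Γ)
    {x : Fin n → ℝ} (hx : x ∈ Γ) : ∃ ε > 0, x - (fun _ => ε) ∈ Γ := by
  have hc : Continuous fun ε : ℝ => x - (fun _ : Fin n => ε) := by fun_prop
  have h : ∀ᶠ ε in nhds (0 : ℝ), x - (fun _ : Fin n => ε) ∈ Γ := by
    refine hc.continuousAt.eventually_mem (hopen.mem_nhds ?_)
    have : x - (fun _ : Fin n => (0 : ℝ)) = x := by ext; simp
    rwa [this]
  obtain ⟨r, hr, h⟩ := Metric.eventually_nhds_iff.1 h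
  refine ⟨r / 2, by positivity, h ?_⟩
  rw [Real.dist_eq, sub_zero, abs_of_pos (by positivity)]
  linarith

/-- The trace as a continuous linear functional on `Herm n`. -/
def hermTrace (n : ℕ) : Herm n →L[ℝ] ℝ :=
  LinearMap.toContinuousLinearMap
    { toFun := fun A => ((A : Matrix (Fin n) (Fin n) ℂ).trace).re
      map_add' := fun A B => by simp
      map_smul' := fun c A => by simp }

lemma hermTrace_pos {n : ℕ} {N : Herm n} (hN : (N : Matrix (Fin n) (Fin n) ℂ).PosSemidef)
    (h0 : N ≠ 0) : 0 < hermTrace n N := by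
  have h1 : 0 ≤ (N : Matrix (Fin n) (Fin n) ℂ).trace := hN.trace_nonneg
  have h2 : (N : Matrix (Fin n) (Fin n) ℂ).trace ≠ 0 := fun h =>
    h0 (Subtype.ext (hN.trace_eq_zero_iff.1 h))
  exact (Complex.pos_iff.1 (lt_of_le_of_ne h1 h2.symm)).1

lemma isClosed_posSemidef (n : ℕ) :
    IsClosed {N : Herm n | (N : Matrix (Fin n) (Fin n) ℂ).PosSemidef} := by
  have h : {N : Herm n | (N : Matrix (Fin n) (Fin n) ℂ).PosSemidef} =
      ⋂ x : Fin n → ℂ, {N : Herm n | 0 ≤ star x ⬝ᵥ ((N : Matrix (Fin n) (Fin n) ℂ).mulVec x)} := by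
    ext N
    simp only [Set.mem_ofPred_eq, Set.mem_iInter]
    exact ⟨fun h x => h.dotProduct_mulVec_nonneg x,
      fun h => Matrix.PosSemidef.of_dotProduct_mulVec_nonneg N.2 h⟩
  rw [h]
  refine isClosed_iInter fun x => ?_
  let l : Herm n →ₗ[ℝ] ℂ :=
    { toFun := fun N => star x ⬝ᵥ ((N : Matrix (Fin n) (Fin n) ℂ).mulVec x)
      map_add' := fun A B => by simp [Matrix.add_mulVec]
      map_smul' := fun c A => by simp [Matrix.smul_mulVec] }
  exact isClosed_le continuous_const l.toContinuousLinearMap.continuous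

/-- A symmetric open convex cone of spectra containing the positive orthant. -/
structure IsSpectralCone {n : ℕ} (Γ : Set (Fin n → ℝ)) : Prop where
  isOpen : IsOpen Γ
  comp_perm_mem : ∀ (σ : Equiv.Perm (Fin n)), ∀ x ∈ Γ, x ∘ σ ∈ Γ
  convex : Convex ℝ Γ
  smul_mem : ∀ c : ℝ, 0 < c → ∀ x ∈ Γ, c • x ∈ Γ
  mem_of_pos : ∀ x : Fin n → ℝ, (∀ i, 0 < x i) → x ∈ Γ

namespace IsSpectralCone

variable {n : ℕ} {Γ : Set (Fin n → ℝ)}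

lemma exists_map_mem (hΓ : IsSpectralCone Γ) (C : Herm n) :
    ∃ L : Herm n →ₗ[ℝ] (Fin n → ℝ),
      L C = sortedEigs (C : Matrix (Fin n) (Fin n) ℂ) ∧ (L (hermOne n) = fun _ => 1) ∧
      ∀ A : Herm n, sortedEigs (A : Matrix (Fin n) (Fin n) ℂ) ∈ Γ → L A ∈ Γ := by
  obtain ⟨L, h₁, h₂, h⟩ := exists_pinching_concaveOn (g := fun _ => 0) hΓ.comp_perm_mem
    (concaveOn_const 0 hΓ.convex) (fun _ _ => rfl) C
  exact ⟨L, h₁, h₂, fun A hA => (h A hA).1⟩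

lemma convex_sortedEigs (hΓ : IsSpectralCone Γ) :
    Convex ℝ {A : Herm n | sortedEigs (A : Matrix (Fin n) (Fin n) ℂ) ∈ Γ} :=
  (concaveOn_comp_sortedEigs (g := fun _ => 0) hΓ.comp_perm_mem
    (concaveOn_const 0 hΓ.convex) fun _ _ => rfl).1

lemma smul_sortedEigs_mem (hΓ : IsSpectralCone Γ) {c : ℝ} (hc : 0 < c) {A : Herm n}
    (hA : sortedEigs (A : Matrix (Fin n) (Fin n) ℂ) ∈ Γ) :
    sortedEigs ((c • A : Herm n) : Matrix (Fin n) (Fin n) ℂ) ∈ Γ := by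
  obtain ⟨L, h₁, -, h⟩ := hΓ.exists_map_mem (c • A)
  rw [← h₁, map_smul]
  exact hΓ.smul_mem c hc _ (h A hA)

lemma add_sortedEigs_mem (hΓ : IsSpectralCone Γ) {A B : Herm n}
    (hA : sortedEigs (A : Matrix (Fin n) (Fin n) ℂ) ∈ Γ)
    (hB : sortedEigs (B : Matrix (Fin n) (Fin n) ℂ) ∈ Γ) :
    sortedEigs ((A + B : Herm n) : Matrix (Fin n) (Fin n) ℂ) ∈ Γ := by
  have h := hΓ.smul_sortedEigs_mem two_pos (hΓ.convex_sortedEigs hA hB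
    (by norm_num : (0 : ℝ) ≤ 1 / 2) (by norm_num : (0 : ℝ) ≤ 1 / 2) (by norm_num))
  rwa [smul_add, smul_smul, smul_smul, mul_one_div_cancel two_ne_zero, one_smul, one_smul] at h

lemma sortedEigs_mem_of_posDef (hΓ : IsSpectralCone Γ) {A : Matrix (Fin n) (Fin n) ℂ}
    (hA : A.PosDef) : sortedEigs A ∈ Γ :=
  hΓ.mem_of_pos _ fun i => sortedEigs_pos hA i

lemma exists_sub_smul_one_mem (hΓ : IsSpectralCone Γ) {A : Herm n}
    (hA : sortedEigs (A : Matrix (Fin n) (Fin n) ℂ) ∈ Γ) :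
    ∃ ε : ℝ, 0 < ε ∧ sortedEigs ((A - ε • hermOne n : Herm n) : Matrix (Fin n) (Fin n) ℂ) ∈ Γ := by
  obtain ⟨ε, hε, hmem⟩ := exists_sub_const_mem_of_isOpen hΓ.isOpen hA
  refine ⟨ε, hε, ?_⟩
  obtain ⟨L, h₁, h₂, h⟩ := exists_pinching (A - ε • hermOne n)
  obtain ⟨w, hw₀, hw₁, hw⟩ := h A
  have h3 := hΓ.convex.sum_mem (t := Finset.univ) (fun σ _ => hw₀ σ) hw₁
    fun σ _ => hΓ.comp_perm_mem σ _ hmem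
  have h4 : ∑ σ, w σ • ((sortedEigs (A : Matrix (Fin n) (Fin n) ℂ) - fun _ => ε) ∘ σ) =
      L (A - ε • hermOne n) := by
    rw [map_sub, map_smul, hw, h₂]
    ext i
    simp [mul_sub, Finset.sum_sub_distrib, ← Finset.sum_mul, hw₁]
  rwa [← h₁, ← h4]

lemma isOpen_sortedEigs (hΓ : IsSpectralCone Γ) :
    IsOpen {A : Herm n | sortedEigs (A : Matrix (Fin n) (Fin n) ℂ) ∈ Γ} := by
  refine Metric.isOpen_iff.2 fun A hA => ?_
  obtain ⟨ε, hε, hmem⟩ := hΓ.exists_sub_smul_one_mem hA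
  refine ⟨ε, hε, fun B hB => ?_⟩
  rw [mem_ball_iff_norm] at hB
  have h := hΓ.add_sortedEigs_mem hmem (hΓ.sortedEigs_mem_of_posDef (posDef_add_smul_one _ hB))
  have e : A - ε • hermOne n + (B - A + ε • hermOne n) = B := by abel
  rwa [e] at h

lemma add_posSemidef_mem (hΓ : IsSpectralCone Γ) {A N : Herm n}
    (hA : sortedEigs (A : Matrix (Fin n) (Fin n) ℂ) ∈ Γ)
    (hN : (N : Matrix (Fin n) (Fin n) ℂ).PosSemidef) :
    sortedEigs ((A + N : Herm n) : Matrix (Fin n) (Fin n) ℂ) ∈ Γ := by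
  obtain ⟨ε, hε, hmem⟩ := hΓ.exists_sub_smul_one_mem hA
  have h1 : ((ε • hermOne n : Herm n) : Matrix (Fin n) (Fin n) ℂ).PosDef := by
    simpa using posDef_add_smul_one (0 : Herm n) (ε := ε) (by simpa using hε)
  have h2 : ((N + ε • hermOne n : Herm n) : Matrix (Fin n) (Fin n) ℂ).PosDef :=
    Matrix.PosDef.posSemidef_add hN h1
  have h := hΓ.add_sortedEigs_mem hmem (hΓ.sortedEigs_mem_of_posDef h2)
  have e : A - ε • hermOne n + (N + ε • hermOne n) = A + N := by abel
  rwa [e] at h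

lemma sortedEigs_mem_closure (hΓ : IsSpectralCone Γ) {A : Herm n}
    (hA : A ∈ closure {A : Herm n | sortedEigs (A : Matrix (Fin n) (Fin n) ℂ) ∈ Γ}) :
    sortedEigs (A : Matrix (Fin n) (Fin n) ℂ) ∈ closure Γ := by
  have key : ∀ ε : ℝ, 0 < ε →
      sortedEigs (A : Matrix (Fin n) (Fin n) ℂ) + ε • (fun _ => 1) ∈ Γ := by
    intro ε hε
    obtain ⟨B, hB, hBA⟩ := Metric.mem_closure_iff.1 hA ε hε
    rw [dist_eq_norm] at hBA
    have h := hΓ.add_sortedEigs_mem hB (hΓ.sortedEigs_mem_of_posDef (posDef_add_smul_one _ hBA))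
    have e : B + (A - B + ε • hermOne n) = A + ε • hermOne n := by abel
    rw [e] at h
    obtain ⟨L, h₁, h₂, hL⟩ := hΓ.exists_map_mem A
    have h3 := hL _ h
    rwa [map_add, map_smul, h₁, h₂] at h3
  have hc : Continuous fun ε : ℝ =>
      sortedEigs (A : Matrix (Fin n) (Fin n) ℂ) + ε • (fun _ : Fin n => (1 : ℝ)) := by fun_prop
  have ht := (hc.tendsto 0).mono_left (nhdsWithin_le_nhds (s := Set.Ioi 0))
  rw [zero_smul, add_zero] at ht
  exact mem_closure_of_tendsto ht (Filter.eventually_of_mem self_mem_nhdsWithin key)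

end IsSpectralCone

lemma mem_frontier_sum_pos {n : ℕ} (hn : n ≠ 0) {x : Fin n → ℝ} (hx : ∑ i, x i = 0) :
    x ∈ frontier {x : Fin n → ℝ | 0 < ∑ i, x i} := by
  have hopen : IsOpen {x : Fin n → ℝ | 0 < ∑ i, x i} :=
    isOpen_lt continuous_const (by fun_prop)
  rw [hopen.frontier_eq]
  refine ⟨?_, by simp [hx]⟩
  have hc : Continuous fun ε : ℝ => x + ε • (fun _ : Fin n => (1 : ℝ)) := by fun_prop
  have ht := (hc.tendsto 0).mono_left (nhdsWithin_le_nhds (s := Set.Ioi 0))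
  rw [zero_smul, add_zero] at ht
  refine mem_closure_of_tendsto ht (Filter.eventually_of_mem self_mem_nhdsWithin fun ε hε => ?_)
  simpa [Finset.sum_add_distrib, hx] using
    mul_pos (Nat.cast_pos.2 (Nat.pos_of_ne_zero hn) : (0 : ℝ) < n) hε

/-- Let `F̂ ∈ C^∞(ℝⁿ)` be a symmetric polynomial, homogeneous of degree
`d ≥ 1`, with `F̂(λ)^{1/d} ≥ C₀(∏λᵢ)^{1/n}` on `Γₙ` for some `C₀ > 0`, and let
`Γ ⊂ ℝⁿ` be a nonempty open symmetric convex cone with `Γₙ ⊆ Γ ⊆ Γ₁`,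
`∂Γ ∩ ∂Γ₁ = {0}`, `F̂ > 0` in `Γ`, `F̂ = 0` on `∂Γ`, and `F̂^{1/d}` concave in `Γ`.
Then `𝒞 = λ⁻¹(Γ) ⊆ ℍⁿ` is a nonempty open convex cone with `𝒞ₙ ⊆ 𝒞 ⊆ 𝒞₁`, and
`F = F̂ ∘ λ` is `C^∞` on all of `ℍⁿ` (in particular `C¹` up to `closure 𝒞`), positive
on `𝒞`, positively homogeneous of degree `d` on `𝒞`, with `F^{1/d}` concave on `𝒞`,
`F(P)^{1/d} ≥ C₀(det P)^{1/n}` for positive definite `P`, and uniformly elliptic on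
`𝒞_R` for every sufficiently large `R`. -/
theorem hessian_operator_framework (n : ℕ) (Fh : (Fin n → ℝ) → ℝ) (d : ℕ) (hd : 1 ≤ d)
    (hpoly : ∃ P : MvPolynomial (Fin n) ℝ, ∀ x, Fh x = MvPolynomial.eval x P)
    (hsymm : ∀ (σ : Equiv.Perm (Fin n)) (x : Fin n → ℝ), Fh (x ∘ σ) = Fh x)
    (hhom : ∀ (c : ℝ) (x : Fin n → ℝ), Fh (c • x) = c ^ d * Fh x)
    (C₀ : ℝ) (hC₀ : 0 < C₀)
    (hcomp : ∀ lam : Fin n → ℝ, (∀ i, 0 < lam i) →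
      C₀ * (∏ i, lam i) ^ ((1 : ℝ) / (n : ℝ)) ≤ Fh lam ^ ((1 : ℝ) / (d : ℝ)))
    (Γ : Set (Fin n → ℝ)) (hne : Γ.Nonempty) (hopen : IsOpen Γ)
    (hΓsymm : ∀ (σ : Equiv.Perm (Fin n)), ∀ x ∈ Γ, x ∘ σ ∈ Γ)
    (hconv : Convex ℝ Γ) (hcone : ∀ c : ℝ, 0 < c → ∀ x ∈ Γ, c • x ∈ Γ)
    (hΓn : ∀ x : Fin n → ℝ, (∀ i, 0 < x i) → x ∈ Γ)
    (hΓ1 : ∀ x ∈ Γ, 0 < ∑ i, x i)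
    (hbdry : frontier Γ ∩ frontier {x : Fin n → ℝ | 0 < ∑ i, x i} = {0})
    (hpos : ∀ x ∈ Γ, 0 < Fh x) (hzero : ∀ x ∈ frontier Γ, Fh x = 0)
    (hconc : ConcaveOn ℝ Γ (fun x => Fh x ^ ((1 : ℝ) / (d : ℝ)))) :
    ({A : Herm n | sortedEigs (A : Matrix (Fin n) (Fin n) ℂ) ∈ Γ}.Nonempty) ∧
    IsOpen {A : Herm n | sortedEigs (A : Matrix (Fin n) (Fin n) ℂ) ∈ Γ} ∧
    Convex ℝ {A : Herm n | sortedEigs (A : Matrix (Fin n) (Fin n) ℂ) ∈ Γ} ∧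
    (∀ c : ℝ, 0 < c → ∀ A : Herm n,
      sortedEigs (A : Matrix (Fin n) (Fin n) ℂ) ∈ Γ →
      sortedEigs ((c • A : Herm n) : Matrix (Fin n) (Fin n) ℂ) ∈ Γ) ∧
    (∀ A : Herm n, (A : Matrix (Fin n) (Fin n) ℂ).PosDef →
      sortedEigs (A : Matrix (Fin n) (Fin n) ℂ) ∈ Γ) ∧
    (∀ A : Herm n, sortedEigs (A : Matrix (Fin n) (Fin n) ℂ) ∈ Γ →
      0 < ((A : Matrix (Fin n) (Fin n) ℂ).trace).re) ∧
    ContDiff ℝ (⊤ : ℕ∞) (fun A : Herm n => Fh (sortedEigs (A : Matrix (Fin n) (Fin n) ℂ))) ∧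
    (∀ A : Herm n, sortedEigs (A : Matrix (Fin n) (Fin n) ℂ) ∈ Γ →
      0 < Fh (sortedEigs (A : Matrix (Fin n) (Fin n) ℂ))) ∧
    (∀ c : ℝ, 0 < c → ∀ A : Herm n, sortedEigs (A : Matrix (Fin n) (Fin n) ℂ) ∈ Γ →
      Fh (sortedEigs (((c • A : Herm n) : Herm n) : Matrix (Fin n) (Fin n) ℂ))
        = c ^ d * Fh (sortedEigs (A : Matrix (Fin n) (Fin n) ℂ))) ∧
    ConcaveOn ℝ {A : Herm n | sortedEigs (A : Matrix (Fin n) (Fin n) ℂ) ∈ Γ}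
      (fun A : Herm n => Fh (sortedEigs (A : Matrix (Fin n) (Fin n) ℂ)) ^ ((1 : ℝ) / (d : ℝ))) ∧
    (∀ P : Herm n, (P : Matrix (Fin n) (Fin n) ℂ).PosDef →
      C₀ * (((P : Matrix (Fin n) (Fin n) ℂ).det).re) ^ ((1 : ℝ) / (n : ℝ))
        ≤ Fh (sortedEigs (P : Matrix (Fin n) (Fin n) ℂ)) ^ ((1 : ℝ) / (d : ℝ))) ∧
    (∃ R₀ > 0, ∀ R > R₀,
      UnifElliptic (fun A : Herm n => Fh (sortedEigs (A : Matrix (Fin n) (Fin n) ℂ)))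
        (coneR {A : Herm n | sortedEigs (A : Matrix (Fin n) (Fin n) ℂ) ∈ Γ}
          (fun A : Herm n => Fh (sortedEigs (A : Matrix (Fin n) (Fin n) ℂ))) R)) := by
  have hn : n ≠ 0 := by
    rintro rfl
    obtain ⟨x, hx⟩ := hne
    simpa using hΓ1 x hx
  have hd0 : d ≠ 0 := by lia
  have hp : (0 : ℝ) < 1 / (d : ℝ) := by positivity
  have hΓ : IsSpectralCone Γ := ⟨hopen, hΓsymm, hconv, hcone, hΓn⟩
  have hF := contDiff_symmetric_comp_sortedEigs hpoly hsymm
  have hg : ∀ (σ : Equiv.Perm (Fin n)) (x : Fin n → ℝ),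
      Fh (x ∘ σ) ^ ((1 : ℝ) / (d : ℝ)) = Fh x ^ ((1 : ℝ) / (d : ℝ)) := fun σ x => by rw [hsymm]
  have hG := concaveOn_comp_sortedEigs hΓsymm hconc hg
  have htr : ∀ A : Herm n, sortedEigs (A : Matrix (Fin n) (Fin n) ℂ) ∈ Γ →
      0 < ((A : Matrix (Fin n) (Fin n) ℂ).trace).re := fun A hA => by
    rw [← sum_sortedEigs]; exact hΓ1 _ hA
  have hscale : ∀ c : ℝ, 0 < c → ∀ A : Herm n, sortedEigs (A : Matrix (Fin n) (Fin n) ℂ) ∈ Γ →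
      c ^ d * Fh (sortedEigs (A : Matrix (Fin n) (Fin n) ℂ)) ≤
        Fh (sortedEigs ((c • A : Herm n) : Matrix (Fin n) (Fin n) ℂ)) := by
    intro c hc A hA
    obtain ⟨L, h₁, -, h⟩ := exists_pinching_concaveOn hΓsymm hconc hg (c • A)
    obtain ⟨hmem, hle⟩ := h A hA
    rw [← h₁, map_smul, hhom]
    gcongr
    exact (Real.rpow_le_rpow_iff (hpos _ hA).le (hpos _ hmem).le hp).1 hle
  have hcl : ∀ A ∈ closure {A : Herm n | sortedEigs (A : Matrix (Fin n) (Fin n) ℂ) ∈ Γ},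
      0 < Fh (sortedEigs (A : Matrix (Fin n) (Fin n) ℂ)) →
      A ∈ {A : Herm n | sortedEigs (A : Matrix (Fin n) (Fin n) ℂ) ∈ Γ} := by
    intro A hA hFA
    by_contra hnot
    exact hFA.ne' (hzero _ (hopen.frontier_eq ▸ ⟨hΓ.sortedEigs_mem_closure hA, hnot⟩))
  obtain ⟨δ, hδ, hbd⟩ := exists_norm_le_of_pos_on_cone
    (S := closure {A : Herm n | sortedEigs (A : Matrix (Fin n) (Fin n) ℂ) ∈ Γ}) isClosed_closure
    (fun c hc A hA => map_mem_closure (continuous_const_smul c) hA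
      fun B hB => hΓ.smul_sortedEigs_mem hc hB) (hermTrace n) (by
      intro A hA h0
      have hA' := hΓ.sortedEigs_mem_closure hA
      by_cases hmem : sortedEigs (A : Matrix (Fin n) (Fin n) ℂ) ∈ Γ
      · exact htr A hmem
      have hnn : 0 ≤ ∑ i, sortedEigs (A : Matrix (Fin n) (Fin n) ℂ) i :=
        closure_minimal (fun x hx => (hΓ1 x hx).le)
          (isClosed_le continuous_const (by fun_prop :
            Continuous fun x : Fin n → ℝ => ∑ i, x i)) hA'
      change 0 < ((A : Matrix (Fin n) (Fin n) ℂ).trace).re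
      rw [← sum_sortedEigs]
      refine lt_of_le_of_ne hnn fun hs => h0 (eq_zero_of_sortedEigs_eq_zero A ?_)
      have h := hbdry.subset ⟨hopen.frontier_eq ▸ ⟨hA', hmem⟩, mem_frontier_sum_pos hn hs.symm⟩
      exact h)
  refine ⟨⟨hermOne n, hΓ.sortedEigs_mem_of_posDef Matrix.PosDef.one⟩, hΓ.isOpen_sortedEigs,
    hΓ.convex_sortedEigs, fun c hc A hA => hΓ.smul_sortedEigs_mem hc hA,
    fun A hA => hΓ.sortedEigs_mem_of_posDef hA, htr, hF.of_le le_top, fun A hA => hpos _ hA,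
    fun c hc A hA => ?_, hG, fun P hP => ?_, ?_⟩
  · refine le_antisymm ?_ (hscale c hc A hA)
    have h := hscale c⁻¹ (inv_pos.2 hc) (c • A) (hΓ.smul_sortedEigs_mem hc hA)
    rw [inv_smul_smul₀ hc.ne', inv_pow] at h
    rwa [inv_mul_le_iff₀ (by positivity)] at h
  · rw [← prod_sortedEigs]
    exact hcomp _ fun i => sortedEigs_pos hP i
  · refine ⟨1, one_pos, fun R hR => ?_⟩
    obtain ⟨m, M, hm, hmM, h⟩ := exists_ellipticity_bounds hp hΓ.isOpen_sortedEigs hF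
      (fun A hA => hpos _ hA) hG hcl (hermTrace n) htr (isClosed_posSemidef n)
      (fun c hc N hN => hN.smul hc) (fun X hX N hN => hΓ.add_posSemidef_mem hX hN)
      (fun N hN h0 => hermTrace_pos hN h0) hδ hbd (one_pos.trans hR)
    exact ⟨m, M, hm, hmM, fun A hA B hB hAB =>
      h A hA.1 hA.2.1 hA.2.2 B hB.1 hB.2.1 hB.2.2 hAB⟩
end
end

section
/- Let F̂ : ℝⁿ → ℝ be a symmetric polynomial, homogeneous of degree d ∈ ℕ with d ≥ 1, and let Γ ⊂ ℝⁿ be a nonempty open symmetric convex cone with Γₙ ⊂ Γ ⊂ Γ₁, such that F̂ > 0 in Γ, F̂ = 0 on ∂Γ, and F̂^{1/d} is concave in Γ. Then for every λ ∈ Γ and every i ∈ {1,…,n}, the partial derivative satisfies ∂F̂/∂λ_i(λ) > 0. -/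
/-- An open convex cone containing the positive orthant is stable under adding nonnegative
multiples of the coordinate vectors. -/
theorem add_smul_single_mem_of_cone {n : ℕ} {Γ : Set (Fin n → ℝ)} (hopen : IsOpen Γ)
    (hconv : Convex ℝ Γ) (hcone : ∀ c : ℝ, 0 < c → ∀ x ∈ Γ, c • x ∈ Γ)
    (hΓn : ∀ x : Fin n → ℝ, (∀ i, 0 < x i) → x ∈ Γ) {x : Fin n → ℝ} (hx : x ∈ Γ)
    (i : Fin n) {t : ℝ} (ht : 0 ≤ t) : x + t • Pi.single i (1 : ℝ) ∈ Γ := by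
  have hcont : Continuous fun ε : ℝ => x - ε • (1 : Fin n → ℝ) := by fun_prop
  have hev : ∀ᶠ ε in nhdsWithin (0 : ℝ) (Set.Ioi 0), x - ε • (1 : Fin n → ℝ) ∈ Γ :=
    nhdsWithin_le_nhds (hcont.continuousAt.eventually_mem (hopen.mem_nhds (by simpa using hx)))
  obtain ⟨ε, hy, hε⟩ := (hev.and self_mem_nhdsWithin).exists
  have hz : ε • (1 : Fin n → ℝ) + t • Pi.single i (1 : ℝ) ∈ Γ := by
    refine hΓn _ fun j => ?_
    have hj : 0 ≤ (Pi.single i (1 : ℝ) : Fin n → ℝ) j := by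
      by_cases h : j = i
      · subst h; simp
      · simp [h]
    have hε' : 0 < ε := hε
    simp only [Pi.add_apply, Pi.smul_apply, Pi.one_apply, smul_eq_mul, mul_one]
    positivity
  have hmid := hcone 2 two_pos _
    (hconv hy hz (by norm_num : (0 : ℝ) ≤ 1 / 2) (by norm_num : (0 : ℝ) ≤ 1 / 2) (by norm_num))
  convert hmid using 1
  module

/-- If `p` is a real polynomial, positive on `s ⊇ [0, ∞)`, with `p ^ r` concave on `s` for some
`r > 0`, and `p' 0 ≤ 0`, then `p` is constant. -/
theorem Polynomial.eval_eq_eval_zero_of_concaveOn_rpow {p : Polynomial ℝ} {s : Set ℝ} {r : ℝ}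
    (hr : 0 < r) (hs : Set.Ici 0 ⊆ s) (hpos : ∀ t ∈ s, 0 < p.eval t)
    (hconc : ConcaveOn ℝ s fun t => p.eval t ^ r) (hderiv : p.derivative.eval 0 ≤ 0) (t : ℝ) :
    p.eval t = p.eval 0 := by
  have h0 : 0 < p.eval 0 := hpos 0 (hs Set.self_mem_Ici)
  have hg : HasDerivAt (fun t => p.eval t ^ r)
      (p.derivative.eval 0 * r * p.eval 0 ^ (r - 1)) 0 :=
    (p.hasDerivAt 0).rpow_const (Or.inl h0.ne')
  have hg0 : p.derivative.eval 0 * r * p.eval 0 ^ (r - 1) ≤ 0 :=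
    mul_nonpos_of_nonpos_of_nonneg (mul_nonpos_of_nonpos_of_nonneg hderiv hr.le) (by positivity)
  have hle : ∀ u : ℝ, 0 < u → p.eval u ≤ p.eval 0 := fun u hu => by
    have hslope := (hconc.slope_le_of_hasDerivAt (hs Set.self_mem_Ici) (hs hu.le) hu hg).trans hg0
    rw [slope_def_field, sub_zero, div_le_iff₀ hu, zero_mul, sub_nonpos] at hslope
    exact (Real.rpow_le_rpow_iff (hpos u (hs hu.le)).le h0.le hr).1 hslope
  have hbdd : Filter.IsBoundedUnder (· ≤ ·) Filter.atTop fun u => |p.eval u| := by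
    refine Filter.isBoundedUnder_of_eventually_le (a := p.eval 0) ?_
    filter_upwards [Filter.eventually_gt_atTop 0] with u hu
    rw [abs_of_pos (hpos u (hs hu.le))]
    exact hle u hu
  rw [Polynomial.eq_C_of_degree_le_zero (p.isBoundedUnder_abs_atTop_iff.1 hbdd)]
  simp

/-- The restriction of a multivariate polynomial to an affine line is a univariate polynomial. -/
theorem MvPolynomial.exists_polynomial_eval_line {σ R : Type*} [CommRing R] (P : MvPolynomial σ R)
    (x v : σ → R) : ∃ p : Polynomial R, ∀ t, p.eval t = MvPolynomial.eval (x + t • v) P := by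
  refine ⟨MvPolynomial.aeval (fun j => Polynomial.C (x j) + Polynomial.C (v j) * Polynomial.X) P,
    fun t => ?_⟩
  induction P using MvPolynomial.induction_on with
  | C a => simp
  | add p q hp hq => simp only [map_add, Polynomial.eval_add, hp, hq]
  | mul_X p j hp => simp [hp, mul_comm t]


/-- Let `F̂ : ℝⁿ → ℝ` be a symmetric polynomial, homogeneous of degree
`d ≥ 1`, and let `Γ ⊂ ℝⁿ` be a nonempty open symmetric convex cone with `Γₙ ⊆ Γ ⊆ Γ₁`,
such that `F̂ > 0` in `Γ`, `F̂ = 0` on `∂Γ`, and `F̂^{1/d}` is concave in `Γ`. Then for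
every `λ ∈ Γ` and every `i`, the partial derivative `∂F̂/∂λᵢ(λ)` is positive. -/
theorem partials_pos_of_hessian_structure (n : ℕ) (Fh : (Fin n → ℝ) → ℝ) (d : ℕ) (hd : 1 ≤ d)
    (hpoly : ∃ P : MvPolynomial (Fin n) ℝ, ∀ x, Fh x = MvPolynomial.eval x P)
    (hsymm : ∀ (σ : Equiv.Perm (Fin n)) (x : Fin n → ℝ), Fh (x ∘ σ) = Fh x)
    (hhom : ∀ (c : ℝ) (x : Fin n → ℝ), Fh (c • x) = c ^ d * Fh x)
    (Γ : Set (Fin n → ℝ)) (hne : Γ.Nonempty) (hopen : IsOpen Γ)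
    (hΓsymm : ∀ (σ : Equiv.Perm (Fin n)), ∀ x ∈ Γ, x ∘ σ ∈ Γ)
    (hconv : Convex ℝ Γ) (hcone : ∀ c : ℝ, 0 < c → ∀ x ∈ Γ, c • x ∈ Γ)
    (hΓn : ∀ x : Fin n → ℝ, (∀ i, 0 < x i) → x ∈ Γ)
    (hΓ1 : ∀ x ∈ Γ, 0 < ∑ i, x i)
    (hpos : ∀ x ∈ Γ, 0 < Fh x) (hzero : ∀ x ∈ frontier Γ, Fh x = 0)
    (hconc : ConcaveOn ℝ Γ (fun x => Fh x ^ ((1 : ℝ) / (d : ℝ)))) :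
    ∀ x ∈ Γ, ∀ i : Fin n, 0 < fderiv ℝ Fh x (Pi.single i 1) := by
  intro x hx i
  obtain ⟨P, hP⟩ := hpoly
  obtain ⟨p, hp⟩ := P.exists_polynomial_eval_line x (Pi.single i 1)
  have hline : ∀ t, p.eval t = Fh (x + t • Pi.single i (1 : ℝ)) := fun t => by rw [hp, hP]
  have hdiff : DifferentiableAt ℝ Fh x := by
    rw [funext hP]
    exact (AnalyticOnNhd.eval_mvPolynomial P x (Set.mem_univ x)).differentiableAt
  have hderiv : p.derivative.eval 0 = fderiv ℝ Fh x (Pi.single i 1) := by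
    refine (p.hasDerivAt 0).unique ?_
    rw [funext hline]
    exact hdiff.hasFDerivAt.hasLineDerivAt _
  rw [← hderiv]
  by_contra! hle
  have hcont : Continuous fun t : ℝ => x + t • (Pi.single i (1 : ℝ) : Fin n → ℝ) := by fun_prop
  let L : ℝ →ᵃ[ℝ] (Fin n → ℝ) := AffineMap.lineMap x (x + Pi.single i 1)
  have hL (t : ℝ) : L t = x + t • Pi.single i (1 : ℝ) := by
    rw [AffineMap.lineMap_apply_module']
    module
  have hconst := Polynomial.eval_eq_eval_zero_of_concaveOn_rpow
    (s := (fun t : ℝ => x + t • (Pi.single i (1 : ℝ) : Fin n → ℝ)) ⁻¹' Γ)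
    (r := 1 / (d : ℝ)) (by positivity)
    (fun t ht => add_smul_single_mem_of_cone hopen hconv hcone hΓn hx i ht)
    (fun t ht => by rw [hline]; exact hpos _ ht)
    (by
      have h := hconc.comp_affineMap L
      simp only [hline, ← hL]
      exact h)
    hle
  have hout : x + (-∑ j, x j) • Pi.single i (1 : ℝ) ∉ Γ := fun h => by
    simpa [Finset.sum_add_distrib, ← Finset.mul_sum] using hΓ1 _ h
  obtain ⟨t, ht⟩ := nonempty_frontier_iff
    (s := (fun t : ℝ => x + t • (Pi.single i (1 : ℝ) : Fin n → ℝ)) ⁻¹' Γ) |>.2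
    ⟨⟨0, by simpa using hx⟩, (Set.ne_univ_iff_exists_notMem _).2 ⟨_, hout⟩⟩
  have hy := hcont.frontier_preimage_subset Γ ht
  have hFx : p.eval 0 = Fh x := by simp [hline]
  exact (hpos x hx).ne' (by rw [← hFx, ← hconst t, hline, hzero _ hy])
end

section
/- For every k ∈ {2,…,n} and every λ ∈ Γ'_{k−1}, one has (1/k) · MA_k(λ)^{1/C_n^k} ≥ (1/(k−1)) · MA_{k−1}(λ)^{1/C_n^{k−1}}. -/
/-- The `k`-Monge–Ampère polynomial `MA_k(λ) = ∏_{1 ≤ i₁<…<i_k ≤ n} (λ_{i₁}+…+λ_{i_k})`,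
the product ranging over all `k`-element subsets of `{1,…,n}`. -/
noncomputable def MAk (n k : ℕ) (lam : Fin n → ℝ) : ℝ :=
  ∏ s ∈ Finset.powersetCard k (Finset.univ : Finset (Fin n)), ∑ i ∈ s, lam i

open Finset in
/-- Double counting of pairs `(s, i)` with `i ∈ s` and `#s = m + 1` through `s.erase i`. -/
theorem prod_powersetCard_succ_prod_erase {α M : Type*} [Fintype α] [DecidableEq α] [CommMonoid M]
    (m : ℕ) (f : Finset α → M) :
    ∏ s ∈ powersetCard (m + 1) (univ : Finset α), ∏ i ∈ s, f (s.erase i) =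
      (∏ t ∈ powersetCard m (univ : Finset α), f t) ^ (Fintype.card α - m) := by
  have hconst : (∏ t ∈ powersetCard m (univ : Finset α), f t) ^ (Fintype.card α - m) =
      ∏ t ∈ powersetCard m (univ : Finset α), ∏ _i ∈ tᶜ, f t := by
    rw [← prod_pow]
    refine prod_congr rfl fun t ht => ?_
    rw [prod_const, card_compl, (mem_powersetCard.1 ht).2]
  rw [hconst, prod_sigma', prod_sigma']
  refine prod_bij' (fun x _ => ⟨x.1.erase x.2, x.2⟩) (fun x _ => ⟨insert x.2 x.1, x.2⟩)
    ?_ ?_ ?_ ?_ ?_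
  · rintro ⟨s, i⟩ h
    simp only [mem_sigma, mem_powersetCard_univ, mem_compl] at h ⊢
    exact ⟨by rw [card_erase_of_mem h.2, h.1, Nat.add_sub_cancel], notMem_erase i s⟩
  · rintro ⟨t, i⟩ h
    simp only [mem_sigma, mem_powersetCard_univ, mem_compl] at h ⊢
    exact ⟨by rw [card_insert_of_notMem h.2, h.1], mem_insert_self i t⟩
  · rintro ⟨s, i⟩ h
    simp only [mem_sigma] at h
    simp only [insert_erase h.2]
  · rintro ⟨t, i⟩ h
    simp only [mem_sigma, mem_compl] at h
    simp only [erase_insert h.2]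
  · rintro ⟨s, i⟩ _
    rfl

/-- The sums of `f` over the sets `s.erase i`, `i ∈ s`, add up to `#s - 1` times the sum over `s`. -/
theorem sum_sum_erase {α : Type*} [DecidableEq α] (s : Finset α) (f : α → ℝ) :
    ∑ i ∈ s, ∑ j ∈ s.erase i, f j = ((s.card : ℝ) - 1) * ∑ j ∈ s, f j := by
  rw [Finset.sum_congr rfl fun i hi => Finset.sum_erase_eq_sub (f := f) hi,
    Finset.sum_sub_distrib, Finset.sum_const, nsmul_eq_mul]
  ring

/-- The AM-GM inequality for the sums of `f` over the sets `s.erase i`, `i ∈ s`. -/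
theorem prod_sum_erase_rpow_le {α : Type*} [DecidableEq α] (s : Finset α) (hs : s.Nonempty)
    (f : α → ℝ) (hf : ∀ i ∈ s, 0 ≤ ∑ j ∈ s.erase i, f j) :
    (∏ i ∈ s, ∑ j ∈ s.erase i, f j) ^ ((1 : ℝ) / s.card) ≤
      ((s.card : ℝ) - 1) / s.card * ∑ j ∈ s, f j := by
  have hc : (s.card : ℝ) ≠ 0 := Nat.cast_ne_zero.2 hs.card_pos.ne'
  have h := Real.geom_mean_le_arith_mean_weighted s (fun _ => (1 : ℝ) / s.card)
    (fun i => ∑ j ∈ s.erase i, f j) (fun _ _ => by positivity)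
    (by rw [Finset.sum_const, nsmul_eq_mul]; field_simp) hf
  rw [Real.finsetProd_rpow s _ hf, ← Finset.mul_sum, sum_sum_erase] at h
  refine h.trans_eq ?_
  ring

/-- For every `k ∈ {2,…,n}` and every `λ ∈ Γ'_{k−1}` (i.e. every sum of
`k−1` distinct coordinates of `λ` is positive),
`(1/k) · MA_k(λ)^{1/C_n^k} ≥ (1/(k−1)) · MA_{k−1}(λ)^{1/C_n^{k−1}}`. -/
theorem MAk_comparison (n k : ℕ) (hk : 2 ≤ k) (hkn : k ≤ n) (lam : Fin n → ℝ)
    (hlam : ∀ s : Finset (Fin n), s.card = k - 1 → 0 < ∑ i ∈ s, lam i) :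
    (1 / ((k : ℝ) - 1)) * MAk n (k - 1) lam ^ ((1 : ℝ) / (n.choose (k - 1) : ℝ))
      ≤ (1 / (k : ℝ)) * MAk n k lam ^ ((1 : ℝ) / (n.choose k : ℝ)) := by
  obtain ⟨m, rfl⟩ : ∃ m, k = m + 1 := ⟨k - 1, by omega⟩
  simp only [Nat.add_sub_cancel] at hlam ⊢
  have hm : (0 : ℝ) < m := by exact_mod_cast (by omega : 0 < m)
  have hN : (0 : ℝ) < n.choose (m + 1) := by exact_mod_cast Nat.choose_pos hkn
  have hM : (0 : ℝ) < n.choose m := by exact_mod_cast Nat.choose_pos (by omega : m ≤ n)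
  have hchoose : (n.choose (m + 1) : ℝ) * (m + 1) = n.choose m * (n - m : ℕ) := by
    exact_mod_cast Nat.choose_succ_right_eq n m
  have herase : ∀ s ∈ Finset.powersetCard (m + 1) (Finset.univ : Finset (Fin n)), ∀ i ∈ s,
      0 < ∑ j ∈ s.erase i, lam j := fun s hs i hi => hlam _ <| by
    rw [Finset.card_erase_of_mem hi, (Finset.mem_powersetCard.1 hs).2, Nat.add_sub_cancel]
  have hamgm : ∀ s ∈ Finset.powersetCard (m + 1) (Finset.univ : Finset (Fin n)),
      (∏ i ∈ s, ∑ j ∈ s.erase i, lam j) ^ ((1 : ℝ) / (m + 1)) ≤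
        (m : ℝ) / (m + 1) * ∑ j ∈ s, lam j := fun s hs => by
    have hcard := (Finset.mem_powersetCard.1 hs).2
    have h := prod_sum_erase_rpow_le s (Finset.card_pos.1 (by omega)) lam
      fun i hi => (herase s hs i hi).le
    rw [hcard] at h
    push_cast at h
    rwa [add_sub_cancel_right] at h
  have hprod_pos : ∀ s ∈ Finset.powersetCard (m + 1) (Finset.univ : Finset (Fin n)),
      0 < ∏ i ∈ s, ∑ j ∈ s.erase i, lam j := fun s hs => Finset.prod_pos (herase s hs)
  have hpos_m : 0 < MAk n m lam :=
    Finset.prod_pos fun t ht => hlam t (Finset.mem_powersetCard.1 ht).2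
  have hpos_succ : 0 < MAk n (m + 1) lam := Finset.prod_pos fun s hs => by
    have h := (Real.rpow_pos_of_pos (hprod_pos s hs) _).trans_le (hamgm s hs)
    exact pos_of_mul_pos_right h (by positivity)
  have hprod : (MAk n m lam ^ (n - m)) ^ ((1 : ℝ) / (m + 1)) ≤
      ((m : ℝ) / (m + 1)) ^ n.choose (m + 1) * MAk n (m + 1) lam := by
    have h := Finset.prod_le_prod
      (fun s hs => (Real.rpow_pos_of_pos (hprod_pos s hs) ((1 : ℝ) / (m + 1))).le) hamgm
    rw [Real.finsetProd_rpow _ _ fun s hs => (hprod_pos s hs).le,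
      prod_powersetCard_succ_prod_erase m fun t => ∑ j ∈ t, lam j, Finset.prod_mul_distrib,
      Finset.prod_const, Finset.card_powersetCard, Finset.card_univ, Fintype.card_fin] at h
    exact h
  have hroot := Real.rpow_le_rpow (by positivity) hprod
    (by positivity : (0 : ℝ) ≤ 1 / (n.choose (m + 1) : ℝ))
  have hexp : ((n - m : ℕ) : ℝ) * (1 / (m + 1)) * (1 / (n.choose (m + 1) : ℝ)) =
      1 / (n.choose m : ℝ) := by
    field_simp
    linarith
  have hbase : (((m : ℝ) / (m + 1)) ^ n.choose (m + 1)) ^ (1 / (n.choose (m + 1) : ℝ)) =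
      (m : ℝ) / (m + 1) := by
    rw [one_div]
    exact Real.pow_rpow_inv_natCast (by positivity) (Nat.choose_pos hkn).ne'
  rw [Real.mul_rpow (by positivity) hpos_succ.le, hbase, ← Real.rpow_natCast,
    ← Real.rpow_mul hpos_m.le, ← Real.rpow_mul hpos_m.le, hexp] at hroot
  push_cast
  rw [add_sub_cancel_right]
  calc 1 / (m : ℝ) * MAk n m lam ^ (1 / (n.choose m : ℝ))
      ≤ 1 / (m : ℝ) *
          ((m : ℝ) / (m + 1) * MAk n (m + 1) lam ^ (1 / (n.choose (m + 1) : ℝ))) := by gcongr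
    _ = 1 / ((m : ℝ) + 1) * MAk n (m + 1) lam ^ (1 / (n.choose (m + 1) : ℝ)) := by
        field_simp
end

section
/- Let 1 ≤ m < n, β > 0, and define u : ℂⁿ → ℝ by u(z',z'') = (1+|z'|²)|z''|^{2β} for (z',z'') ∈ ℂ^m × ℂ^{n−m}, and let N = {z ∈ ℂⁿ : z'' = 0}. Then u is C^∞ on ℂⁿ ∖ N, and the complex Hessian (D²_ℂ u)(z) is positive definite for every z ∈ ℂⁿ ∖ N. -/
open scoped ComplexOrder

noncomputable section

/-- The direction `∂/∂xᵢ` in `ℂⁿ`. -/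
def ex {n : ℕ} (i : Fin n) : Fin n → ℂ := Pi.single i 1
/-- The direction `∂/∂yᵢ` in `ℂⁿ`. -/
def ey {n : ℕ} (i : Fin n) : Fin n → ℂ := Pi.single i Complex.I

/-- Second directional (real) derivative `∂_v ∂_w u`. -/
def dd2 {n : ℕ} (u : (Fin n → ℂ) → ℝ) (z v w : Fin n → ℂ) : ℝ :=
  fderiv ℝ (fun y => fderiv ℝ u y w) z v

/-- The complex Hessian `(∂²u/∂zᵢ∂z̄ⱼ)_{i,j}`, expressed through real second
derivatives: `∂²u/∂zᵢ∂z̄ⱼ = (1/4)[∂xᵢ∂xⱼu + ∂yᵢ∂yⱼu + i(∂xᵢ∂yⱼu − ∂yᵢ∂xⱼu)]`. -/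
def complexHessian {n : ℕ} (u : (Fin n → ℂ) → ℝ) (z : Fin n → ℂ) :
    Matrix (Fin n) (Fin n) ℂ :=
  Matrix.of fun i j =>
    (((dd2 u z (ex i) (ex j) + dd2 u z (ey i) (ey j) : ℝ) : ℂ)
      + Complex.I * ((dd2 u z (ex i) (ey j) - dd2 u z (ey i) (ex j) : ℝ) : ℂ)) / 4

/-- `|z'|²`: squared norm of the first `m` coordinates. -/
def nsqFirst {n : ℕ} (m : ℕ) (z : Fin n → ℂ) : ℝ :=
  ∑ i ∈ Finset.univ.filter (fun i : Fin n => (i : ℕ) < m), Complex.normSq (z i)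

/-- `|z''|²`: squared norm of the last `n − m` coordinates. -/
def nsqLast {n : ℕ} (m : ℕ) (z : Fin n → ℂ) : ℝ :=
  ∑ i ∈ Finset.univ.filter (fun i : Fin n => m ≤ (i : ℕ)), Complex.normSq (z i)

/-- The Pogorelov-type example `u(z',z'') = (1+|z'|²)·|z''|^{2β}`. -/
def pogorelov {n : ℕ} (m : ℕ) (β : ℝ) (z : Fin n → ℂ) : ℝ :=
  (1 + nsqFirst m z) * Real.sqrt (nsqLast m z) ^ (2 * β)

/-- The singular set `N = {z : z'' = 0}`. -/
def singSet (n m : ℕ) : Set (Fin n → ℂ) := {z | ∀ i : Fin n, m ≤ (i : ℕ) → z i = 0}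

/-- The real inner product on `ℂⁿ` restricted to the coordinates in `s`, as a functional of its
second argument. -/
def partialInner {n : ℕ} (s : Finset (Fin n)) (v : Fin n → ℂ) : (Fin n → ℂ) →L[ℝ] ℝ :=
  ∑ i ∈ s, ((v i).re • (Complex.reCLM ∘L ContinuousLinearMap.proj i) +
    (v i).im • (Complex.imCLM ∘L ContinuousLinearMap.proj i))

lemma partialInner_apply {n : ℕ} (s : Finset (Fin n)) (v w : Fin n → ℂ) :
    partialInner s v w = ∑ i ∈ s, ((v i).re * (w i).re + (v i).im * (w i).im) := by
  simp [partialInner]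

lemma partialInner_comm {n : ℕ} (s : Finset (Fin n)) (v w : Fin n → ℂ) :
    partialInner s v w = partialInner s w v := by
  simp [partialInner_apply, mul_comm]

lemma partialInner_ex {n : ℕ} (s : Finset (Fin n)) (v : Fin n → ℂ) (i : Fin n) :
    partialInner s v (ex i) = if i ∈ s then (v i).re else 0 := by
  rw [partialInner_apply, ← Finset.sum_ite_eq s i (fun j => (v j).re)]
  refine Finset.sum_congr rfl fun j _ => ?_
  by_cases h : i = j
  · subst h; simp [ex]
  · simp [ex, h, Ne.symm h]

lemma partialInner_ey {n : ℕ} (s : Finset (Fin n)) (v : Fin n → ℂ) (i : Fin n) :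
    partialInner s v (ey i) = if i ∈ s then (v i).im else 0 := by
  rw [partialInner_apply, ← Finset.sum_ite_eq s i (fun j => (v j).im)]
  refine Finset.sum_congr rfl fun j _ => ?_
  by_cases h : i = j
  · subst h; simp [ey]
  · simp [ey, h, Ne.symm h]

/-- The squared norm of the coordinates in `s`. -/
def partialNormSq {n : ℕ} (s : Finset (Fin n)) (z : Fin n → ℂ) : ℝ :=
  ∑ i ∈ s, Complex.normSq (z i)

lemma partialNormSq_nonneg {n : ℕ} (s : Finset (Fin n)) (z : Fin n → ℂ) :
    0 ≤ partialNormSq s z :=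
  Finset.sum_nonneg fun _ _ => Complex.normSq_nonneg _

lemma hasFDerivAt_partialInner_left {n : ℕ} (s : Finset (Fin n)) (w y : Fin n → ℂ) :
    HasFDerivAt (fun y => partialInner s y w) (partialInner s w) y := by
  simp_rw [fun y => partialInner_comm s y w]
  exact (partialInner s w).hasFDerivAt

lemma hasFDerivAt_partialNormSq {n : ℕ} (s : Finset (Fin n)) (y : Fin n → ℂ) :
    HasFDerivAt (partialNormSq s) ((2 : ℝ) • partialInner s y) y := by
  have hi : ∀ i ∈ s, HasFDerivAt (fun z : Fin n → ℂ => Complex.normSq (z i))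
      ((2 : ℝ) • ((y i).re • (Complex.reCLM ∘L ContinuousLinearMap.proj i) +
        (y i).im • (Complex.imCLM ∘L ContinuousLinearMap.proj i))) y := by
    intro i _
    have hr := (Complex.reCLM ∘L
      (ContinuousLinearMap.proj (R := ℝ) (φ := fun _ : Fin n => ℂ) i)).hasFDerivAt (x := y)
    have hm := (Complex.imCLM ∘L
      (ContinuousLinearMap.proj (R := ℝ) (φ := fun _ : Fin n => ℂ) i)).hasFDerivAt (x := y)
    refine ((hr.mul hr).add (hm.mul hm)).congr_fderiv ?_
    ext v
    simp
    ring
  refine (HasFDerivAt.fun_sum hi).congr_fderiv ?_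
  rw [partialInner, Finset.smul_sum]

lemma contDiff_partialNormSq {n : ℕ} (s : Finset (Fin n)) {k : WithTop ℕ∞} :
    ContDiff ℝ k (partialNormSq s) := by
  refine ContDiff.sum fun i _ => ?_
  have hr := (Complex.reCLM ∘L
    (ContinuousLinearMap.proj (R := ℝ) (φ := fun _ : Fin n => ℂ) i)).contDiff (n := k)
  have hm := (Complex.imCLM ∘L
    (ContinuousLinearMap.proj (R := ℝ) (φ := fun _ : Fin n => ℂ) i)).contDiff (n := k)
  exact (hr.mul hr).add (hm.mul hm)

/-- The function `(1 + |z_s|²) |z_t|^{2β}`, for two sets `s`, `t` of coordinates. -/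
def pogorelovOn {n : ℕ} (s t : Finset (Fin n)) (β : ℝ) (z : Fin n → ℂ) : ℝ :=
  (1 + partialNormSq s z) * partialNormSq t z ^ β

lemma fderiv_pogorelovOn {n : ℕ} (s t : Finset (Fin n)) (β : ℝ) {y : Fin n → ℂ}
    (hy : partialNormSq t y ≠ 0) (w : Fin n → ℂ) :
    fderiv ℝ (pogorelovOn s t β) y w =
      2 * partialInner s y w * partialNormSq t y ^ β +
      (1 + partialNormSq s y) * (β * partialNormSq t y ^ (β - 1)) *
        (2 * partialInner t y w) := by
  have h := ((hasFDerivAt_partialNormSq s y).const_add 1).mul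
    ((hasFDerivAt_partialNormSq t y).rpow_const (p := β) (Or.inl hy))
  have h' : HasFDerivAt (pogorelovOn s t β) _ y := h
  rw [h'.fderiv]
  simp
  ring

lemma dd2_pogorelovOn {n : ℕ} (s t : Finset (Fin n)) (β : ℝ) {z : Fin n → ℂ}
    (hz : partialNormSq t z ≠ 0) (v w : Fin n → ℂ) :
    dd2 (pogorelovOn s t β) z v w =
      2 * partialNormSq t z ^ β * partialInner s v w +
      4 * (β * partialNormSq t z ^ (β - 1)) *
        (partialInner s z v * partialInner t z w + partialInner t z v * partialInner s z w) +
      4 * ((1 + partialNormSq s z) * (β * (β - 1) * partialNormSq t z ^ (β - 2))) *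
        (partialInner t z v * partialInner t z w) +
      2 * ((1 + partialNormSq s z) * (β * partialNormSq t z ^ (β - 1))) *
        partialInner t v w := by
  have hev : (fun y => fderiv ℝ (pogorelovOn s t β) y w) =ᶠ[nhds z] fun y =>
      2 * partialInner s y w * partialNormSq t y ^ β +
      (1 + partialNormSq s y) * (β * partialNormSq t y ^ (β - 1)) *
        (2 * partialInner t y w) := by
    filter_upwards [(contDiff_partialNormSq t (k := 0)).continuous.continuousAt.eventually_ne hz]
      with y hy using fderiv_pogorelovOn s t β hy w
  have hB := hasFDerivAt_partialNormSq t z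
  have h := (((hasFDerivAt_partialInner_left s w z).const_mul 2).mul
      (hB.rpow_const (p := β) (Or.inl hz))).add
    ((((hasFDerivAt_partialNormSq s z).const_add 1).mul
      ((hB.rpow_const (p := β - 1) (Or.inl hz)).const_mul β)).mul
      ((hasFDerivAt_partialInner_left t w z).const_mul 2))
  rw [dd2, hev.fderiv_eq]
  refine (congrArg (· v) h.fderiv).trans ?_
  have e : β - 1 - 1 = β - 2 := by ring
  simp [e, partialInner_comm _ w v]
  ring

/-- The vector with entries `conj zᵢ` for `i ∈ s`, and zero elsewhere. -/
def partialConj {n : ℕ} (s : Finset (Fin n)) (z : Fin n → ℂ) (i : Fin n) : ℂ :=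
  if i ∈ s then star (z i) else 0

lemma complexHessian_pogorelovOn {n : ℕ} (s t : Finset (Fin n)) (β : ℝ) {z : Fin n → ℂ}
    (hz : partialNormSq t z ≠ 0) (i j : Fin n) :
    complexHessian (pogorelovOn s t β) z i j =
      (partialNormSq t z ^ β : ℝ) * (if i = j then if i ∈ s then 1 else 0 else 0) +
      (β * partialNormSq t z ^ (β - 1) : ℝ) *
        (partialConj s z i * star (partialConj t z j) +
          partialConj t z i * star (partialConj s z j)) +
      ((1 + partialNormSq s z) * (β * (β - 1) * partialNormSq t z ^ (β - 2)) : ℝ) *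
        (partialConj t z i * star (partialConj t z j)) +
      ((1 + partialNormSq s z) * (β * partialNormSq t z ^ (β - 1)) : ℝ) *
        (if i = j then if i ∈ t then 1 else 0 else 0) := by
  simp only [complexHessian, Matrix.of_apply, dd2_pogorelovOn s t β hz, partialInner_ex,
    partialInner_ey]
  generalize partialNormSq t z ^ β = c₁
  generalize β * partialNormSq t z ^ (β - 1) = c₂
  generalize (1 + partialNormSq s z) * (β * (β - 1) * partialNormSq t z ^ (β - 2)) = c₃
  generalize (1 + partialNormSq s z) * c₂ = c₄
  have hx : ∀ r : Finset (Fin n), (if j ∈ r then ((ex i : Fin n → ℂ) j).re else 0) =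
      if i = j then if i ∈ r then 1 else 0 else 0 := by
    intro r
    by_cases h : i = j
    · subst h; simp [ex]
    · simp [ex, h, Ne.symm h]
  have hx' : ∀ r : Finset (Fin n), (if j ∈ r then ((ex i : Fin n → ℂ) j).im else 0) = 0 := by
    intro r
    by_cases h : i = j
    · subst h; simp [ex]
    · simp [ex, Ne.symm h]
  have hy : ∀ r : Finset (Fin n), (if j ∈ r then ((ey i : Fin n → ℂ) j).im else 0) =
      if i = j then if i ∈ r then 1 else 0 else 0 := by
    intro r
    by_cases h : i = j
    · subst h; simp [ey]
    · simp [ey, h, Ne.symm h]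
  have hy' : ∀ r : Finset (Fin n), (if j ∈ r then ((ey i : Fin n → ℂ) j).re else 0) = 0 := by
    intro r
    by_cases h : i = j
    · subst h; simp [ey]
    · simp [ey, Ne.symm h]
  simp only [hx, hx', hy, hy']
  have hP : ∀ (r : Finset (Fin n)) k, partialConj r z k =
      ((if k ∈ r then (z k).re else 0 : ℝ) : ℂ) -
        ((if k ∈ r then (z k).im else 0 : ℝ) : ℂ) * Complex.I := by
    intro r k
    unfold partialConj
    split_ifs <;> apply Complex.ext <;> simp
  have hd : ∀ r : Finset (Fin n), (if i = j then if i ∈ r then 1 else 0 else 0 : ℂ) =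
      ((if i = j then if i ∈ r then 1 else 0 else 0 : ℝ) : ℂ) := by
    intro r
    split_ifs <;> simp
  simp only [hP, hd]
  generalize (if i = j then if i ∈ s then 1 else 0 else 0 : ℝ) = d₁
  generalize (if i = j then if i ∈ t then 1 else 0 else 0 : ℝ) = d₂
  generalize (if i ∈ s then (z i).re else 0) = a₁
  generalize (if i ∈ s then (z i).im else 0) = a₂
  generalize (if i ∈ t then (z i).re else 0) = a₃
  generalize (if i ∈ t then (z i).im else 0) = a₄
  generalize (if j ∈ s then (z j).re else 0) = b₁
  generalize (if j ∈ s then (z j).im else 0) = b₂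
  generalize (if j ∈ t then (z j).re else 0) = b₃
  generalize (if j ∈ t then (z j).im else 0) = b₄
  apply Complex.ext <;> simp <;> ring

/-- The Hermitian pairing `∑_{i ∈ s} conj (zᵢ xᵢ)`. -/
def partialPairing {n : ℕ} (s : Finset (Fin n)) (z x : Fin n → ℂ) : ℂ :=
  ∑ i ∈ s, star (x i) * star (z i)

lemma norm_partialPairing_sq_le {n : ℕ} (s : Finset (Fin n)) (z x : Fin n → ℂ) :
    ‖partialPairing s z x‖ ^ 2 ≤ partialNormSq s z * partialNormSq s x := by
  have h₁ : ‖partialPairing s z x‖ ≤ ∑ i ∈ s, ‖x i‖ * ‖z i‖ :=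
    (norm_sum_le _ _).trans_eq (Finset.sum_congr rfl fun i _ => by simp)
  calc ‖partialPairing s z x‖ ^ 2 ≤ (∑ i ∈ s, ‖x i‖ * ‖z i‖) ^ 2 := by gcongr
    _ ≤ (∑ i ∈ s, ‖x i‖ ^ 2) * ∑ i ∈ s, ‖z i‖ ^ 2 := Finset.sum_mul_sq_le_sq_mul_sq _ _ _
    _ = partialNormSq s z * partialNormSq s x := by
      simp only [partialNormSq, Complex.normSq_eq_norm_sq]
      ring

lemma sum_star_mul_partialConj {n : ℕ} (s : Finset (Fin n)) (z x : Fin n → ℂ) :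
    ∑ i, star (x i) * partialConj s z i = partialPairing s z x := by
  simp [partialConj, partialPairing, Finset.sum_ite_mem]

lemma sum_star_partialConj_mul {n : ℕ} (s : Finset (Fin n)) (z x : Fin n → ℂ) :
    ∑ i, star (partialConj s z i) * x i = star (partialPairing s z x) := by
  rw [← sum_star_mul_partialConj, star_sum]
  exact Finset.sum_congr rfl fun i _ => by simp [mul_comm]

lemma dotProduct_complexHessian_pogorelovOn {n : ℕ} (s t : Finset (Fin n)) (β : ℝ)
    {z : Fin n → ℂ} (hz : partialNormSq t z ≠ 0) (x : Fin n → ℂ) :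
    star x ⬝ᵥ (complexHessian (pogorelovOn s t β) z).mulVec x =
      ((partialNormSq t z ^ β * partialNormSq s x +
      (β * partialNormSq t z ^ (β - 1)) *
        (2 * (partialPairing s z x * star (partialPairing t z x)).re) +
      (1 + partialNormSq s z) * (β * (β - 1) * partialNormSq t z ^ (β - 2)) *
        ‖partialPairing t z x‖ ^ 2 +
      (1 + partialNormSq s z) * (β * partialNormSq t z ^ (β - 1)) *
        partialNormSq t x : ℝ) : ℂ) := by
  have hrank : ∀ p q : Finset (Fin n),
      ∑ i, ∑ j, star (x i) * ((partialConj p z i * star (partialConj q z j)) * x j) =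
        partialPairing p z x * star (partialPairing q z x) := by
    intro p q
    rw [← sum_star_mul_partialConj, ← sum_star_partialConj_mul, Finset.sum_mul_sum]
    exact Finset.sum_congr rfl fun i _ => Finset.sum_congr rfl fun j _ => by ring
  have hdiag : ∀ p : Finset (Fin n),
      ∑ i, ∑ j, star (x i) * ((if i = j then if i ∈ p then 1 else 0 else 0) * x j) =
        (partialNormSq p x : ℂ) := by
    intro p
    simp [partialNormSq, Finset.sum_ite_mem, Complex.normSq_eq_conj_mul_self]
  simp only [dotProduct, Matrix.mulVec, Pi.star_apply, Finset.mul_sum,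
    complexHessian_pogorelovOn s t β hz]
  generalize partialNormSq t z ^ β = c₁
  generalize β * partialNormSq t z ^ (β - 1) = c₂
  generalize (1 + partialNormSq s z) * (β * (β - 1) * partialNormSq t z ^ (β - 2)) = c₃
  generalize (1 + partialNormSq s z) * c₂ = c₄
  have hsplit : ∀ e₁ e₂ e₃ e₄ e₅ : Fin n → Fin n → ℂ,
      ∑ i, ∑ j, star (x i) * (((c₁ : ℂ) * e₁ i j + (c₂ : ℂ) * (e₂ i j + e₃ i j) +
        (c₃ : ℂ) * e₄ i j + (c₄ : ℂ) * e₅ i j) * x j) =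
      c₁ * ∑ i, ∑ j, star (x i) * (e₁ i j * x j) +
      c₂ * (∑ i, ∑ j, star (x i) * (e₂ i j * x j) + ∑ i, ∑ j, star (x i) * (e₃ i j * x j)) +
      c₃ * ∑ i, ∑ j, star (x i) * (e₄ i j * x j) +
      c₄ * ∑ i, ∑ j, star (x i) * (e₅ i j * x j) := by
    intro e₁ e₂ e₃ e₄ e₅
    simp only [Finset.mul_sum, ← Finset.sum_add_distrib]
    exact Finset.sum_congr rfl fun i _ => Finset.sum_congr rfl fun j _ => by ring
  rw [hsplit, hdiag, hdiag, hrank, hrank, hrank]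
  rw [← Complex.normSq_eq_norm_sq]
  apply Complex.ext
  · simp [Complex.normSq_apply]
    exact Or.inl (by ring)
  · simp [Complex.normSq_apply]
    ring

lemma pogorelov_levi_pos {A B a b p q r β : ℝ} (hβ : 0 < β) (hA : 0 ≤ A) (hB : 0 < B)
    (ha : 0 ≤ a) (hb : 0 ≤ b) (hab : 0 < a + b) (hp : p ^ 2 ≤ A * a) (hq : q ^ 2 ≤ B * b)
    (hr : |r| ≤ p * q) :
    0 < B ^ β * a + (β * B ^ (β - 1)) * (2 * r) +
      (1 + A) * (β * (β - 1) * B ^ (β - 2)) * q ^ 2 + (1 + A) * (β * B ^ (β - 1)) * b := by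
  have hC : 0 < B ^ (β - 2) := Real.rpow_pos_of_pos hB _
  have h₁ : B ^ (β - 1) = B ^ (β - 2) * B := by
    rw [← Real.rpow_add_one hB.ne']; congr 1; ring
  have h₀ : B ^ β = B ^ (β - 2) * B * B := by
    rw [← h₁, ← Real.rpow_add_one hB.ne']; congr 1; ring
  rw [h₀, h₁]
  have hr' : -(p * q) ≤ r := (abs_le.mp hr).1
  have hmain : 0 < B ^ 2 * a - 2 * β * B * (p * q) + (1 + A) * β ^ 2 * q ^ 2 +
      (1 + A) * β * (B * b - q ^ 2) := by
    have hs : 0 ≤ B ^ 2 * a - 2 * β * B * (p * q) + A * β ^ 2 * q ^ 2 := by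
      rcases ha.eq_or_lt with rfl | ha'
      · have : p = 0 := by nlinarith
        subst this
        simp
        positivity
      · have h : 0 ≤ a * (B ^ 2 * a - 2 * β * B * (p * q) + A * β ^ 2 * q ^ 2) := by
          nlinarith [sq_nonneg (B * a - β * (p * q)),
            mul_le_mul_of_nonneg_left hp (sq_nonneg (β * q))]
        exact nonneg_of_mul_nonneg_right h ha'
    have hA' : 0 < 1 + A := by linarith
    have hd : 0 ≤ (1 + A) * β * (B * b - q ^ 2) :=
      mul_nonneg (by positivity) (by linarith)
    by_cases hq0 : q = 0
    · subst hq0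
      have : 0 < B * (B * a + (1 + A) * β * b) := by
        refine mul_pos hB ?_
        rcases ha.eq_or_lt with rfl | ha'
        · have : 0 < b := by linarith
          positivity
        · positivity
      nlinarith
    · have : 0 < β ^ 2 * q ^ 2 := by positivity
      nlinarith
  have h2 : 0 ≤ 2 * β * B * (r + p * q) := mul_nonneg (by positivity) (by linarith)
  have := mul_pos hC (add_pos_of_pos_of_nonneg hmain h2)
  refine this.trans_eq ?_
  ring

lemma posDef_complexHessian_pogorelovOn {n : ℕ} {s t : Finset (Fin n)}
    (hst : ∀ i, i ∈ s ∨ i ∈ t) {β : ℝ} (hβ : 0 < β) {z : Fin n → ℂ}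
    (hz : partialNormSq t z ≠ 0) :
    (complexHessian (pogorelovOn s t β) z).PosDef := by
  refine Matrix.PosDef.of_dotProduct_mulVec_pos ?_ fun x hx => ?_
  · ext i j
    rw [Matrix.conjTranspose_apply, complexHessian_pogorelovOn s t β hz,
      complexHessian_pogorelovOn s t β hz]
    by_cases h : i = j
    · subst h
      split_ifs <;> simp <;> ring
    · simp [h, Ne.symm h]
      ring
  · rw [dotProduct_complexHessian_pogorelovOn s t β hz, Complex.zero_lt_real]
    refine pogorelov_levi_pos (p := ‖partialPairing s z x‖) hβ (partialNormSq_nonneg s z)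
      ((partialNormSq_nonneg t z).lt_of_ne' hz) (partialNormSq_nonneg s x)
      (partialNormSq_nonneg t x) ?_ (norm_partialPairing_sq_le s z x)
      (norm_partialPairing_sq_le t z x) ?_
    · obtain ⟨i, hi⟩ := Function.ne_iff.mp hx
      have hi' : 0 < Complex.normSq (x i) := Complex.normSq_pos.mpr hi
      have hle : ∀ p : Finset (Fin n), i ∈ p → Complex.normSq (x i) ≤ partialNormSq p x :=
        fun p hp => Finset.single_le_sum (f := fun k => Complex.normSq (x k))
          (fun k _ => Complex.normSq_nonneg _) hp
      rcases hst i with h | h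
      · linarith [hle s h, partialNormSq_nonneg t x]
      · linarith [hle t h, partialNormSq_nonneg s x]
    · refine (Complex.abs_re_le_norm _).trans_eq ?_
      rw [norm_mul, norm_star]

lemma pogorelov_eq_pogorelovOn {n : ℕ} (m : ℕ) (β : ℝ) :
    pogorelov (n := n) m β = pogorelovOn (Finset.univ.filter fun i : Fin n => (i : ℕ) < m)
      (Finset.univ.filter fun i : Fin n => m ≤ (i : ℕ)) β := by
  funext z
  have h : 0 ≤ nsqLast m z := partialNormSq_nonneg _ z
  rw [pogorelov, Real.sqrt_eq_rpow, ← Real.rpow_mul h]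
  have e : 1 / 2 * (2 * β) = β := by ring
  rw [e]
  rfl

lemma partialNormSq_ne_zero_of_notMem_singSet {n m : ℕ} {z : Fin n → ℂ}
    (hz : z ∉ singSet n m) :
    partialNormSq (Finset.univ.filter fun i : Fin n => m ≤ (i : ℕ)) z ≠ 0 := by
  contrapose! hz
  intro i hi
  rw [partialNormSq, Finset.sum_eq_zero_iff_of_nonneg fun _ _ => Complex.normSq_nonneg _] at hz
  exact Complex.normSq_eq_zero.mp (hz i (by simpa using hi))

/-- For `1 ≤ m < n` and `β > 0`, the function
`u(z',z'') = (1+|z'|²)|z''|^{2β}` is `C^∞` on `ℂⁿ ∖ N` (`N = {z'' = 0}`), and its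
complex Hessian is positive definite at every point of `ℂⁿ ∖ N`. -/
theorem pogorelov_smooth_and_posdef (n m : ℕ) (hm : 1 ≤ m) (hmn : m < n)
    (β : ℝ) (hβ : 0 < β) :
    ContDiffOn ℝ (⊤ : ℕ∞) (pogorelov (n := n) m β) (singSet n m)ᶜ ∧
    ∀ z ∉ singSet n m, (complexHessian (pogorelov (n := n) m β) z).PosDef := by
  rw [pogorelov_eq_pogorelovOn]
  refine ⟨fun z hz => ContDiffAt.contDiffWithinAt ?_, fun z hz =>
    posDef_complexHessian_pogorelovOn (fun i => ?_) hβ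
      (partialNormSq_ne_zero_of_notMem_singSet hz)⟩
  · exact (contDiffAt_const.add (contDiff_partialNormSq _).contDiffAt).mul
      ((contDiff_partialNormSq _).contDiffAt.rpow_const_of_ne
        (partialNormSq_ne_zero_of_notMem_singSet hz))
  · simpa using lt_or_ge (i : ℕ) m
end
end

section
/- Let 1 ≤ m < n, β > 0, u(z',z'') = (1+|z'|²)|z''|^{2β} on ℂ^m × ℂ^{n−m}, and N = {z : z'' = 0}. Then for every z ∈ ℂⁿ ∖ N, det((D²_ℂ u)(z)) = β^{n−m+1} (1+|z'|²)^{n−m−1} |z''|^{2βn − 2(n−m)}. -/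
open scoped ComplexOrder

noncomputable section

/-- The real bilinear form `2 ∑_{i ∈ s} Re(z̄ᵢ wᵢ)`, as a continuous linear functional of `w`. -/
def reForm {n : ℕ} (s : Finset (Fin n)) (z : Fin n → ℂ) : (Fin n → ℂ) →L[ℝ] ℝ :=
  ∑ i ∈ s, ((2 * (z i).re) • Complex.reCLM.comp (ContinuousLinearMap.proj i)
    + (2 * (z i).im) • Complex.imCLM.comp (ContinuousLinearMap.proj i))

theorem reForm_apply {n : ℕ} (s : Finset (Fin n)) (z w : Fin n → ℂ) :
    reForm s z w = ∑ i ∈ s, (2 * (z i).re * (w i).re + 2 * (z i).im * (w i).im) := by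
  simp [reForm]

theorem reForm_comm {n : ℕ} (s : Finset (Fin n)) (z w : Fin n → ℂ) :
    reForm s z w = reForm s w z := by
  rw [reForm_apply, reForm_apply]
  exact Finset.sum_congr rfl fun i _ => by ring

theorem reForm_ex {n : ℕ} (s : Finset (Fin n)) (z : Fin n → ℂ) (j : Fin n) :
    reForm s z (ex j) = if j ∈ s then 2 * (z j).re else 0 := by
  rw [reForm_apply, ← Finset.sum_ite_eq' s j (fun i => 2 * (z i).re)]
  refine Finset.sum_congr rfl fun i _ => ?_
  by_cases h : i = j
  · subst h; simp [ex]
  · simp [ex, h]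

theorem reForm_ey {n : ℕ} (s : Finset (Fin n)) (z : Fin n → ℂ) (j : Fin n) :
    reForm s z (ey j) = if j ∈ s then 2 * (z j).im else 0 := by
  rw [reForm_apply, ← Finset.sum_ite_eq' s j (fun i => 2 * (z i).im)]
  refine Finset.sum_congr rfl fun i _ => ?_
  by_cases h : i = j
  · subst h; simp [ey]
  · simp [ey, h]

theorem hasFDerivAt_sum_normSq {n : ℕ} (s : Finset (Fin n)) (z : Fin n → ℂ) :
    HasFDerivAt (fun y : Fin n → ℂ => ∑ i ∈ s, Complex.normSq (y i)) (reForm s z) z := by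
  unfold reForm
  refine HasFDerivAt.fun_sum fun i _ => ?_
  have hre : HasFDerivAt (fun y : Fin n → ℂ => (y i).re)
      (Complex.reCLM.comp (ContinuousLinearMap.proj (R := ℝ) (φ := fun _ : Fin n => ℂ) i)) z :=
    (Complex.reCLM.comp
      (ContinuousLinearMap.proj (R := ℝ) (φ := fun _ : Fin n => ℂ) i)).hasFDerivAt
  have him : HasFDerivAt (fun y : Fin n → ℂ => (y i).im)
      (Complex.imCLM.comp (ContinuousLinearMap.proj (R := ℝ) (φ := fun _ : Fin n => ℂ) i)) z :=
    (Complex.imCLM.comp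
      (ContinuousLinearMap.proj (R := ℝ) (φ := fun _ : Fin n => ℂ) i)).hasFDerivAt
  simp only [Complex.normSq_apply]
  refine ((hre.mul hre).add (him.mul him)).congr_fderiv ?_
  ext w
  simp
  ring

theorem hasFDerivAt_reForm_left {n : ℕ} (s : Finset (Fin n)) (z w : Fin n → ℂ) :
    HasFDerivAt (fun y => reForm s y w) (reForm s w) z := by
  simp only [reForm_comm s _ w]
  exact (reForm s w).hasFDerivAt

/-- The index set of the first `m` coordinates. -/
def firstIdx (n m : ℕ) : Finset (Fin n) := Finset.univ.filter (fun i : Fin n => (i : ℕ) < m)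

/-- The index set of the last `n - m` coordinates. -/
def lastIdx (n m : ℕ) : Finset (Fin n) := Finset.univ.filter (fun i : Fin n => m ≤ (i : ℕ))

theorem nsqFirst_nonneg {n : ℕ} (m : ℕ) (z : Fin n → ℂ) : 0 ≤ nsqFirst m z :=
  Finset.sum_nonneg fun _ _ => Complex.normSq_nonneg _

theorem nsqLast_nonneg {n : ℕ} (m : ℕ) (z : Fin n → ℂ) : 0 ≤ nsqLast m z :=
  Finset.sum_nonneg fun _ _ => Complex.normSq_nonneg _

theorem nsqLast_pos {n m : ℕ} {z : Fin n → ℂ} (hz : z ∉ singSet n m) : 0 < nsqLast m z := by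
  simp only [singSet, Set.mem_ofPred_eq, not_forall] at hz
  obtain ⟨i, hi, hzi⟩ := hz
  exact Finset.sum_pos' (fun _ _ => Complex.normSq_nonneg _)
    ⟨i, by simpa using hi, Complex.normSq_pos.2 hzi⟩

theorem hasFDerivAt_nsqFirst {n : ℕ} (m : ℕ) (z : Fin n → ℂ) :
    HasFDerivAt (nsqFirst m) (reForm (firstIdx n m) z) z :=
  hasFDerivAt_sum_normSq _ z

theorem hasFDerivAt_nsqLast {n : ℕ} (m : ℕ) (z : Fin n → ℂ) :
    HasFDerivAt (nsqLast m) (reForm (lastIdx n m) z) z :=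
  hasFDerivAt_sum_normSq _ z

theorem sqrt_rpow_eq {x : ℝ} (hx : 0 ≤ x) (a : ℝ) : Real.sqrt x ^ (2 * a) = x ^ a := by
  rw [Real.rpow_mul (Real.sqrt_nonneg x), Real.rpow_two, Real.sq_sqrt hx]

theorem pogorelov_eq {n : ℕ} (m : ℕ) (β : ℝ) :
    pogorelov (n := n) m β = fun z => (1 + nsqFirst m z) * nsqLast m z ^ β := by
  funext z
  rw [pogorelov, sqrt_rpow_eq (nsqLast_nonneg m z)]

theorem hasFDerivAt_nsqLast_rpow {n m : ℕ} (β : ℝ) {z : Fin n → ℂ} (hz : 0 < nsqLast m z) :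
    HasFDerivAt (fun y : Fin n → ℂ => nsqLast m y ^ β)
      ((β * nsqLast m z ^ (β - 1)) • reForm (lastIdx n m) z) z :=
  (hasFDerivAt_nsqLast m z).rpow_const (Or.inl hz.ne')

theorem fderiv_pogorelov {n m : ℕ} (β : ℝ) {z : Fin n → ℂ} (hz : 0 < nsqLast m z)
    (w : Fin n → ℂ) :
    fderiv ℝ (pogorelov m β) z w =
      (1 + nsqFirst m z) * (β * nsqLast m z ^ (β - 1) * reForm (lastIdx n m) z w)
        + nsqLast m z ^ β * reForm (firstIdx n m) z w := by
  rw [pogorelov_eq, (((hasFDerivAt_nsqFirst m z).const_add 1).fun_mul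
    (hasFDerivAt_nsqLast_rpow β hz)).fderiv]
  simp [mul_assoc]

theorem dd2_pogorelov {n m : ℕ} (β : ℝ) {z : Fin n → ℂ} (hz : 0 < nsqLast m z)
    (v w : Fin n → ℂ) :
    dd2 (pogorelov m β) z v w =
      nsqLast m z ^ β * reForm (firstIdx n m) w v
      + β * nsqLast m z ^ (β - 1) *
        (reForm (firstIdx n m) z v * reForm (lastIdx n m) z w
          + reForm (lastIdx n m) z v * reForm (firstIdx n m) z w)
      + (1 + nsqFirst m z) * (β * nsqLast m z ^ (β - 1) * reForm (lastIdx n m) w v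
        + β * (β - 1) * nsqLast m z ^ (β - 2) *
          (reForm (lastIdx n m) z v * reForm (lastIdx n m) z w)) := by
  have hev : (fun y => fderiv ℝ (pogorelov m β) y w) =ᶠ[nhds z] fun y =>
      (1 + nsqFirst m y) * (β * nsqLast m y ^ (β - 1) * reForm (lastIdx n m) y w)
        + nsqLast m y ^ β * reForm (firstIdx n m) y w := by
    filter_upwards [(hasFDerivAt_nsqLast m z).continuousAt.eventually (lt_mem_nhds hz)] with y hy
    exact fderiv_pogorelov β hy w
  have hd := (((hasFDerivAt_nsqFirst m z).const_add 1).mul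
    (((hasFDerivAt_nsqLast_rpow (β - 1) hz).const_mul β).mul
      (hasFDerivAt_reForm_left (lastIdx n m) z w))).add
    ((hasFDerivAt_nsqLast_rpow β hz).mul (hasFDerivAt_reForm_left (firstIdx n m) z w))
  rw [dd2, hev.fderiv_eq]
  refine (congrArg (fun L => L v) hd.fderiv).trans ?_
  have h2 : β - 1 - 1 = β - 2 := by ring
  simp [h2]
  ring

/-- The entries of the complex Hessian. -/
theorem complexHessian_pogorelov_apply {n m : ℕ} (β : ℝ) {z : Fin n → ℂ}
    (hz : 0 < nsqLast m z) (i j : Fin n) :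
    complexHessian (pogorelov m β) z i j =
      if (i : ℕ) < m then
        if (j : ℕ) < m then if i = j then ((nsqLast m z ^ β : ℝ) : ℂ) else 0
        else ((β * nsqLast m z ^ (β - 1) : ℝ) : ℂ) * (starRingEnd ℂ (z i) * z j)
      else
        if (j : ℕ) < m then ((β * nsqLast m z ^ (β - 1) : ℝ) : ℂ) * (starRingEnd ℂ (z i) * z j)
        else (if i = j then (((1 + nsqFirst m z) * (β * nsqLast m z ^ (β - 1)) : ℝ) : ℂ) else 0)
          + (((1 + nsqFirst m z) * (β * (β - 1) * nsqLast m z ^ (β - 2)) : ℝ) : ℂ)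
            * (starRingEnd ℂ (z i) * z j) := by
  simp only [complexHessian, Matrix.of_apply, dd2_pogorelov β hz, reForm_ex, reForm_ey]
  generalize nsqLast m z ^ β = p
  generalize nsqLast m z ^ (β - 1) = q
  generalize nsqLast m z ^ (β - 2) = r
  generalize nsqFirst m z = a
  by_cases hij : i = j
  · subst hij
    by_cases hi : (i : ℕ) < m <;>
      simp [firstIdx, lastIdx, hi, not_le.2, not_lt.1, ex, ey, Complex.ext_iff] <;>
      (try constructor) <;> ring
  · by_cases hi : (i : ℕ) < m <;> by_cases hj : (j : ℕ) < m <;>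
      simp [firstIdx, lastIdx, hi, hj, hij, not_le.2, not_lt.1, ex, ey, Complex.ext_iff] <;>
      (try constructor) <;> ring

theorem complexHessian_pogorelov_eq {n m : ℕ} {β : ℝ} {z : Fin n → ℂ}
    (hz : 0 < nsqLast m z) (c d e f : ℂ) (hc : c = ((nsqLast m z ^ β : ℝ) : ℂ))
    (hd : d = (((1 + nsqFirst m z) * (β * nsqLast m z ^ (β - 1)) : ℝ) : ℂ))
    (he : e = ((β * nsqLast m z ^ (β - 1) : ℝ) : ℂ))
    (hf : f = (((1 + nsqFirst m z) * (β * (β - 1) * nsqLast m z ^ (β - 2)) : ℝ) : ℂ))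
    (hc0 : c ≠ 0) (hd0 : d ≠ 0) :
    complexHessian (pogorelov m β) z =
      Matrix.diagonal (fun i : Fin n => if (i : ℕ) < m then c else d) *
      (1 + Matrix.of (fun (i : Fin n) (k : Fin 2) =>
            if (i : ℕ) < m then ![starRingEnd ℂ (z i) / c, 0] k
            else ![0, starRingEnd ℂ (z i) / d] k)
        * Matrix.of (fun (k : Fin 2) (j : Fin n) =>
            if (j : ℕ) < m then ![0, e * z j] k else ![e * z j, f * z j] k)) := by
  ext i j
  rw [complexHessian_pogorelov_apply β hz, ← hc, ← hd, ← he, ← hf, Matrix.diagonal_mul]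
  simp only [Matrix.add_apply, Matrix.mul_apply, Fin.sum_univ_two, Matrix.one_apply,
    Matrix.of_apply]
  by_cases hij : i = j
  · subst hij
    by_cases hi : (i : ℕ) < m <;> simp [hi] <;> field_simp
  · by_cases hi : (i : ℕ) < m <;> by_cases hj : (j : ℕ) < m <;> simp [hi, hj, hij] <;> field_simp

theorem sum_ite_normSq_first {n : ℕ} (m : ℕ) (z : Fin n → ℂ) (a : ℂ) :
    ∑ i : Fin n, (if (i : ℕ) < m then a * (z i * starRingEnd ℂ (z i)) else 0)
      = a * (nsqFirst m z : ℂ) := by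
  rw [nsqFirst, Complex.ofReal_sum, Finset.mul_sum, Finset.sum_filter]
  simp only [Complex.mul_conj]

theorem sum_ite_normSq_last {n : ℕ} (m : ℕ) (z : Fin n → ℂ) (a : ℂ) :
    ∑ i : Fin n, (if (i : ℕ) < m then 0 else a * (z i * starRingEnd ℂ (z i)))
      = a * (nsqLast m z : ℂ) := by
  rw [nsqLast, Complex.ofReal_sum, Finset.mul_sum, Finset.sum_filter]
  simp only [Complex.mul_conj, ← not_lt, ite_not]

theorem prod_ite_lt {n m : ℕ} (hmn : m ≤ n) (c d : ℂ) :
    ∏ i : Fin n, (if (i : ℕ) < m then c else d) = c ^ m * d ^ (n - m) := by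
  obtain ⟨k, rfl⟩ := Nat.exists_eq_add_of_le hmn
  simp [Fin.prod_univ_add]

/-- A diagonal matrix with a rank-two perturbation: the determinant reduces to a `2 × 2` one. -/
theorem det_diagonal_mul_one_add {n m : ℕ} (hmn : m ≤ n) (z : Fin n → ℂ) (c d e f : ℂ) :
    (Matrix.diagonal (fun i : Fin n => if (i : ℕ) < m then c else d) *
      (1 + Matrix.of (fun (i : Fin n) (k : Fin 2) =>
            if (i : ℕ) < m then ![starRingEnd ℂ (z i) / c, 0] k
            else ![0, starRingEnd ℂ (z i) / d] k)
        * Matrix.of (fun (k : Fin 2) (j : Fin n) =>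
            if (j : ℕ) < m then ![0, e * z j] k else ![e * z j, f * z j] k))).det
      = c ^ m * d ^ (n - m) *
        (1 + f / d * nsqLast m z - e / d * nsqLast m z * (e / c * nsqFirst m z)) := by
  rw [Matrix.det_mul, Matrix.det_diagonal, prod_ite_lt hmn, Matrix.det_one_add_mul_comm,
    Matrix.det_fin_two]
  congr 1
  simp only [Matrix.add_apply, Matrix.mul_apply, Matrix.one_apply, Matrix.of_apply]
  rw [← sum_ite_normSq_last m z (f / d), ← sum_ite_normSq_last m z (e / d),
    ← sum_ite_normSq_first m z (e / c)]
  have h00 : ∑ x : Fin n, (if (x : ℕ) < m then (![0, e * z x] : Fin 2 → ℂ) 0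
      else ![e * z x, f * z x] 0) * (if (x : ℕ) < m then ![starRingEnd ℂ (z x) / c, 0] 0
      else ![0, starRingEnd ℂ (z x) / d] 0) = 0 :=
    Finset.sum_eq_zero fun x _ => by by_cases hx : (x : ℕ) < m <;> simp [hx]
  rw [h00]
  simp only [Matrix.cons_val_zero, Matrix.cons_val_one, if_true, add_zero, one_mul,
    zero_ne_one, one_ne_zero, if_false, zero_add]
  congr 1
  · congr 1
    refine Finset.sum_congr rfl fun x _ => ?_
    by_cases hx : (x : ℕ) < m <;> simp [hx]
    ring
  · congr 1 <;> refine Finset.sum_congr rfl fun x _ => ?_ <;>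
      by_cases hx : (x : ℕ) < m <;> simp [hx] <;> ring

/-- The scalar identity behind the determinant formula. -/
theorem pogorelov_scalar_identity (m k : ℕ) {β P S : ℝ} (hβ : 0 < β) (hP : 0 < P) (hS : 0 < S) :
    (S ^ β) ^ m * (P * (β * S ^ (β - 1))) ^ (k + 1) *
      (1 + P * (β * (β - 1) * S ^ (β - 2)) / (P * (β * S ^ (β - 1))) * S
        - β * S ^ (β - 1) / (P * (β * S ^ (β - 1))) * S
          * (β * S ^ (β - 1) / S ^ β * (P - 1)))
      = β ^ (k + 2) * P ^ k * S ^ (β * (m + k + 1) - (k + 1)) := by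
  have h1 : S ^ (β - 1) = S ^ β / S := by rw [Real.rpow_sub hS, Real.rpow_one]
  have h2 : S ^ (β - 2) = S ^ β / S ^ 2 := by rw [Real.rpow_sub hS, Real.rpow_two]
  have h3 : S ^ (β * (m + k + 1) - (k + 1)) = (S ^ β) ^ (m + k + 1) / S ^ (k + 1) := by
    rw [Real.rpow_sub hS, Real.rpow_mul hS.le]
    norm_cast
  have hq : 0 < S ^ β := Real.rpow_pos_of_pos hS β
  rw [h1, h2, h3]
  generalize S ^ β = q at hq
  have key : 1 + P * (β * (β - 1) * (q / S ^ 2)) / (P * (β * (q / S))) * S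
        - β * (q / S) / (P * (β * (q / S))) * S * (β * (q / S) / q * (P - 1)) = β / P := by
    field_simp
    ring
  rw [key, mul_pow, mul_pow, div_pow]
  field_simp
  ring

/-- For `1 ≤ m < n`, `β > 0` and `u(z',z'') = (1+|z'|²)|z''|^{2β}`, at
every `z ∉ N = {z'' = 0}` the determinant of the complex Hessian equals
`β^{n−m+1} (1+|z'|²)^{n−m−1} |z''|^{2βn − 2(n−m)}`. -/
theorem pogorelov_hessian_det (n m : ℕ) (hm : 1 ≤ m) (hmn : m < n)
    (β : ℝ) (hβ : 0 < β) :
    ∀ z ∉ singSet n m,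
      (complexHessian (pogorelov (n := n) m β) z).det
        = ((β ^ (n - m + 1) * (1 + nsqFirst m z) ^ (n - m - 1)
            * Real.sqrt (nsqLast m z) ^ (2 * β * (n : ℝ) - 2 * ((n : ℝ) - (m : ℝ))) : ℝ) : ℂ) := by
  intro z hz
  have hS := nsqLast_pos hz
  have hP : 0 < 1 + nsqFirst m z := by linarith [nsqFirst_nonneg m z]
  have hq := Real.rpow_pos_of_pos hS β
  have hq1 := Real.rpow_pos_of_pos hS (β - 1)
  rw [complexHessian_pogorelov_eq hS _ _ _ _ rfl rfl rfl rfl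
    (Complex.ofReal_ne_zero.2 hq.ne') (Complex.ofReal_ne_zero.2 (by positivity)),
    det_diagonal_mul_one_add hmn.le]
  obtain ⟨k, rfl⟩ := Nat.exists_eq_add_of_lt hmn
  have hk : m + k + 1 - m = k + 1 := by omega
  have hexp : 2 * β * ((m + k + 1 : ℕ) : ℝ) - 2 * (((m + k + 1 : ℕ) : ℝ) - m)
      = 2 * (β * (m + k + 1) - (k + 1)) := by
    push_cast
    ring
  rw [hk, hexp, sqrt_rpow_eq hS.le, Nat.add_sub_cancel,
    ← pogorelov_scalar_identity m k hβ hP hS, add_sub_cancel_left]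
  push_cast
  ring
end
end
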